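/- Let d ≥ 1, let μ be a stationary ergodic probability measure on 𝒮(d), and let ℰ : S(d) → S(d) be a measurable map, extended to environments by ℰ(ω)(x) = ℰ(ω(x)), such that ℰ(ω) is balanced for every ω, ℰ(ω) is elliptic for μ-a.e. ω, and ∫ c(ℰ(ω),0)^{−p} dμ(ω) < ∞ for some p > d. Then there exists b ∈ S(d) such that for μ-a.e. ω, lim_{n→∞} (1/n) Σ_{k=0}^{n−1} ℰ(ω)(X(k)) = b holds P_0^{ℰ(ω)}-almost surely, where X is the trajectory of the random walk in the environment ℰ(ω) started at 0 and ℰ(ω)(X(k)) is viewed as a point of S(d) ⊂ ℝ^{V_d}. -/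

import Mathlib

open MeasureTheory Filter Topology
open scoped ENNReal NNReal

noncomputable section

abbrev Zd (d : ℕ) := Fin d → ℤ

/-- The `i`-th standard unit vector of `ℤ^d`. -/
def eZ (d : ℕ) (i : Fin d) : Zd d := Pi.single i 1

/-- `V_d = {±e_1, …, ±e_d, 0}`. -/
def Vfin (d : ℕ) : Finset (Zd d) :=
  ((Finset.univ.image fun i : Fin d => eZ d i) ∪
    (Finset.univ.image fun i : Fin d => -eZ d i)) ∪ {0}

/-- `S(d)`: probability vectors indexed by `V_d` (as functions on `ℤ^d` supported on `V_d`). -/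
def Sd (d : ℕ) : Set (Zd d → ℝ) :=
  {p | (∀ v, 0 ≤ p v) ∧ (∀ v ∉ Vfin d, p v = 0) ∧ ∑ v ∈ Vfin d, p v = 1}

/-- `𝒮(d)`: environments, i.e. maps `ℤ^d → S(d)`, with the product σ-algebra. -/
abbrev Env (d : ℕ) := Zd d → Sd d

/-- The shift `τ_x` on environments. -/
def shiftE {d : ℕ} (x : Zd d) (ω : Env d) : Env d := fun y => ω (x + y)

/-- `μ` is stationary and ergodic with respect to the group of shifts. -/
def StationaryErgodic {d : ℕ} (μ : Measure (Env d)) : Prop :=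
  (∀ x : Zd d, Measure.map (shiftE x) μ = μ) ∧
  ∀ B : Set (Env d), MeasurableSet B → (∀ x : Zd d, shiftE x ⁻¹' B = B) →
    μ B = 0 ∨ μ B = 1

/-- `c(ℰ(ω), x) = (∏_{v ∈ V_d ∖ {0}} ℰ(ω)(x,v))^{1/(2d)}`. -/
def cE (d : ℕ) (E : Sd d → Sd d) (ω : Env d) (x : Zd d) : ℝ :=
  (∏ v ∈ (Vfin d).erase 0, (E (ω x)).1 v) ^ (2 * (d : ℝ))⁻¹

/-- `P` is the quenched law `P_{x₀}^ω` of the random walk in the environment `ω` started at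
`x₀`: the (unique, Ionescu–Tulcea) probability measure on trajectories whose finite-dimensional
distributions are the products of the one-step transition probabilities `ω(y, v)`. -/
def IsQuenchedLaw (d : ℕ) (ω : Env d) (x₀ : Zd d) (P : Measure (ℕ → Zd d)) : Prop :=
  IsProbabilityMeasure P ∧
  ∀ (n : ℕ) (y : ℕ → Zd d),
    P {X | ∀ k ≤ n, X k = y k} =
      (if y 0 = x₀ then
          ∏ k ∈ Finset.range n, ENNReal.ofReal ((ω (y k)).1 (y (k + 1) - y k))
        else 0)

/-- The arithmetic-geometric mean inequality in power form. -/
lemma prod_le_sum_div_pow {d : ℕ} (hd : 1 ≤ d) (z : Fin d → ℝ) (hz : ∀ i, 0 ≤ z i) :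
    ∏ i, z i ≤ ((∑ i, z i) / d) ^ d := by
  have hd0 : (d : ℝ) ≠ 0 := by positivity
  have h := Real.geom_mean_le_arith_mean Finset.univ (fun _ => (1 : ℝ)) z (fun _ _ => zero_le_one)
    (by simp; omega) (fun i _ => hz i)
  simp only [Real.rpow_one, Finset.sum_const, Finset.card_univ, Fintype.card_fin, nsmul_eq_mul,
    mul_one, one_mul] at h
  have h2 := pow_le_pow_left₀ (Real.rpow_nonneg (Finset.prod_nonneg fun i _ => hz i) _) h d
  rwa [← Real.rpow_natCast, ← Real.rpow_mul (Finset.prod_nonneg fun i _ => hz i),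
    inv_mul_cancel₀ hd0, Real.rpow_one] at h2

/-- The lattice box of radius `R`. -/
def latticeBox (d R : ℕ) : Finset (Zd d) := Finset.Icc (fun _ => -(R : ℤ)) (fun _ => (R : ℤ))

lemma mem_latticeBox {d R : ℕ} {x : Zd d} : x ∈ latticeBox d R ↔ ∀ i, |x i| ≤ (R : ℤ) := by
  simp only [latticeBox, Finset.mem_Icc, Pi.le_def, abs_le, forall_and]

lemma zero_mem_latticeBox (d R : ℕ) : (0 : Zd d) ∈ latticeBox d R := by
  simp [mem_latticeBox]

lemma card_latticeBox (d R : ℕ) : (latticeBox d R).card = (2 * R + 1) ^ d := by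
  rw [latticeBox, Pi.card_Icc]
  simp only [Int.card_Icc, Finset.prod_const, Finset.card_univ, Fintype.card_fin]
  congr 1
  omega

lemma add_eZ_mem_latticeBox {d R : ℕ} {x : Zd d} (hx : x ∈ latticeBox d R) (i : Fin d) :
    x + eZ d i ∈ latticeBox d (R + 1) ∧ x - eZ d i ∈ latticeBox d (R + 1) := by
  rw [mem_latticeBox] at *
  simp only [mem_latticeBox, eZ, Pi.add_apply, Pi.sub_apply, Pi.single_apply]
  constructor <;> intro j <;> have := hx j <;> rw [abs_le] at * <;> split_ifs <;> push_cast <;>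
    constructor <;> linarith

/-- The discrete Aleksandrov-Bakelman-Pucci estimate on a lattice box. -/
theorem discrete_abp {d : ℕ} (hd : 1 ≤ d) (R : ℕ) (α : Zd d → Fin d → ℝ)
    (u g : Zd d → ℝ) (hα : ∀ x i, 0 < α x i) (hu : ∀ x ∉ latticeBox d R, u x ≤ 0)
    (hg : ∀ x, 0 ≤ g x)
    (hsub : ∀ x ∈ latticeBox d R,
      ∑ i, α x i * (2 * u x - u (x + eZ d i) - u (x - eZ d i)) ≤ g x)
    (h0 : 0 ≤ u 0) :
    u 0 ^ d ≤ ((R + 1) / 2 : ℝ) ^ d * ∑ x ∈ latticeBox d R, g x ^ d / ∏ i, α x i := by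
  have hdpos : (0 : ℝ) < d := by exact_mod_cast hd
  have hterm : ∀ x, 0 ≤ g x ^ d / ∏ i, α x i := fun x =>
    div_nonneg (pow_nonneg (hg x) _) (Finset.prod_nonneg fun i _ => (hα x i).le)
  rcases h0.eq_or_lt with h0 | hM
  · rw [← h0, zero_pow (by omega)]
    exact mul_nonneg (by positivity) (Finset.sum_nonneg fun x _ => hterm x)
  set r : ℝ := u 0 / (d * (R + 1)) with hr
  have hrpos : 0 < r := by positivity
  have hrM : r * (d * (R + 1)) = u 0 := by rw [hr]; field_simp
  let I : Zd d → Set (Fin d → ℝ) := fun x =>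
    Set.Icc (fun i => u (x + eZ d i) - u x) (fun i => u x - u (x - eZ d i))
  have hcover : (Set.univ.pi fun _ : Fin d => Set.Ioo (-r) r) ⊆ ⋃ x ∈ latticeBox d R, I x := by
    intro s hs
    have hs' : ∀ i, |s i| < r := fun i => abs_lt.2 (hs i (Set.mem_univ i))
    let f : Zd d → ℝ := fun z => u z - ∑ i, s i * (z i : ℝ)
    obtain ⟨x, hx, hmax⟩ := Finset.exists_max_image (latticeBox d (R + 1)) f
      ⟨0, zero_mem_latticeBox _ _⟩
    have hxB : x ∈ latticeBox d R := by
      by_contra hxB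
      have h1 := hmax 0 (zero_mem_latticeBox _ _)
      have h2 := hu x hxB
      have h3 : -∑ i, s i * (x i : ℝ) < u 0 := by
        rw [← hrM, ← Finset.sum_neg_distrib]
        have : (r * (d * (R + 1)) : ℝ) = ∑ _i : Fin d, r * (R + 1) := by
          simp; ring
        rw [this]
        refine Finset.sum_lt_sum_of_nonempty ⟨⟨0, hd⟩, Finset.mem_univ _⟩ fun i _ => ?_
        have h4 : |(x i : ℝ)| ≤ R + 1 := by
          have := mem_latticeBox.1 hx i
          exact_mod_cast this
        calc -(s i * (x i : ℝ)) ≤ |s i| * |(x i : ℝ)| := by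
              rw [← abs_mul]; exact neg_le_abs _
          _ ≤ |s i| * (R + 1) := by gcongr
          _ < r * (R + 1) := by gcongr; exact hs' i
      simp only [f, Pi.zero_apply, Int.cast_zero, mul_zero, Finset.sum_const_zero] at h1
      linarith
    refine Set.mem_biUnion hxB ?_
    have hsum : ∀ i, ∑ j, s j * ((eZ d i j : ℤ) : ℝ) = s i := by
      intro i
      simp [eZ, Pi.single_apply]
    simp only [I, Set.mem_Icc, Pi.le_def]
    constructor <;> intro i
    · have h1 := hmax _ (add_eZ_mem_latticeBox hxB i).1
      simp only [f, Pi.add_apply, Int.cast_add, mul_add, Finset.sum_add_distrib, hsum] at h1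
      linarith
    · have h1 := hmax _ (add_eZ_mem_latticeBox hxB i).2
      simp only [f, Pi.sub_apply, Int.cast_sub, mul_sub, Finset.sum_sub_distrib, hsum] at h1
      linarith
  have hvolI : ∀ x ∈ latticeBox d R,
      volume (I x) ≤ ENNReal.ofReal ((g x / d) ^ d / ∏ i, α x i) := by
    intro x hx
    rw [Real.volume_Icc_pi]
    by_cases hD : ∀ i, 0 ≤ u x - u (x - eZ d i) - (u (x + eZ d i) - u x)
    · rw [← ENNReal.ofReal_prod_of_nonneg fun i _ => hD i]
      refine ENNReal.ofReal_le_ofReal ?_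
      rw [le_div_iff₀ (Finset.prod_pos fun i _ => hα x i), mul_comm, ← Finset.prod_mul_distrib]
      refine (prod_le_sum_div_pow hd _ fun i => mul_nonneg (hα x i).le (hD i)).trans ?_
      have hnn : 0 ≤ ∑ i, α x i * (u x - u (x - eZ d i) - (u (x + eZ d i) - u x)) :=
        Finset.sum_nonneg fun i _ => mul_nonneg (hα x i).le (hD i)
      gcongr
      refine le_trans (le_of_eq (Finset.sum_congr rfl fun i _ => ?_)) (hsub x hx)
      ring
    · push Not at hD
      obtain ⟨i, hi⟩ := hD
      rw [Finset.prod_eq_zero (Finset.mem_univ i) (ENNReal.ofReal_of_nonpos hi.le)]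
      exact zero_le
  have hvol : ENNReal.ofReal ((2 * r) ^ d) ≤
      ENNReal.ofReal (∑ x ∈ latticeBox d R, (g x / d) ^ d / ∏ i, α x i) := by
    have h1 : volume (Set.univ.pi fun _ : Fin d => Set.Ioo (-r) r) =
        ENNReal.ofReal ((2 * r) ^ d) := by
      rw [Real.volume_pi_Ioo, ← ENNReal.ofReal_prod_of_nonneg fun i _ => by linarith]
      simp; ring_nf
    rw [← h1, ENNReal.ofReal_sum_of_nonneg fun x _ => ?_]
    · exact (measure_mono hcover).trans ((measure_biUnion_finset_le _ _).trans
        (Finset.sum_le_sum hvolI))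
    · exact div_nonneg (pow_nonneg (div_nonneg (hg x) hdpos.le) _)
        (Finset.prod_nonneg fun i _ => (hα x i).le)
  rw [ENNReal.ofReal_le_ofReal_iff (Finset.sum_nonneg fun x _ =>
    div_nonneg (pow_nonneg (div_nonneg (hg x) hdpos.le) _)
      (Finset.prod_nonneg fun i _ => (hα x i).le))] at hvol
  have h2 : u 0 ^ d = (d * ((R + 1) / 2)) ^ d * (2 * r) ^ d := by
    rw [← mul_pow, ← hrM]; ring_nf
  rw [h2]
  refine (mul_le_mul_of_nonneg_left hvol (by positivity)).trans (le_of_eq ?_)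
  rw [Finset.mul_sum, Finset.mul_sum]
  refine Finset.sum_congr rfl fun x _ => ?_
  rw [div_pow, mul_pow]
  field_simp

lemma eZ_injective (d : ℕ) : Function.Injective (eZ d) := by
  intro i j h
  by_contra hij
  have := congrFun h i
  simp [eZ, hij] at this

lemma eZ_ne_neg {d : ℕ} (i j : Fin d) : eZ d i ≠ -eZ d j := by
  intro h
  have := congrFun h i
  simp only [eZ, Pi.single_apply, Pi.neg_apply, if_true] at this
  split_ifs at this
  all_goals omega

lemma eZ_ne_zero {d : ℕ} (i : Fin d) : eZ d i ≠ 0 := by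
  intro h
  have := congrFun h i
  simp [eZ] at this

lemma eZ_mem_Vfin {d : ℕ} (i : Fin d) : eZ d i ∈ Vfin d := by
  simp [Vfin]

lemma zero_notMem_units (d : ℕ) :
    (0 : Zd d) ∉ (Finset.univ.image fun i : Fin d => eZ d i) ∪
      (Finset.univ.image fun i : Fin d => -eZ d i) := by
  simp [eZ_ne_zero]

lemma disjoint_units (d : ℕ) :
    Disjoint (Finset.univ.image fun i : Fin d => eZ d i)
      (Finset.univ.image fun i : Fin d => -eZ d i) := by
  rw [Finset.disjoint_left]
  intro v hv hv'
  simp only [Finset.mem_image, Finset.mem_univ, true_and] at hv hv'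
  obtain ⟨i, rfl⟩ := hv
  obtain ⟨j, hj⟩ := hv'
  exact eZ_ne_neg i j hj.symm

lemma sum_Vfin {d : ℕ} {M : Type*} [AddCommMonoid M] (F : Zd d → M) :
    ∑ v ∈ Vfin d, F v = ∑ i, (F (eZ d i) + F (-eZ d i)) + F 0 := by
  rw [Vfin, Finset.sum_union (by simpa using zero_notMem_units d),
    Finset.sum_union (disjoint_units d), Finset.sum_singleton,
    Finset.sum_image (fun i _ j _ h => eZ_injective d h),
    Finset.sum_image (fun i _ j _ h => eZ_injective d (neg_injective h)), Finset.sum_add_distrib]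

lemma prod_Vfin_erase {d : ℕ} {M : Type*} [CommMonoid M] (F : Zd d → M) :
    ∏ v ∈ (Vfin d).erase 0, F v = ∏ i, (F (eZ d i) * F (-eZ d i)) := by
  have h : (Vfin d).erase 0 = (Finset.univ.image fun i : Fin d => eZ d i) ∪
      (Finset.univ.image fun i : Fin d => -eZ d i) := by
    rw [Vfin, Finset.union_comm, ← Finset.insert_eq, Finset.erase_insert (zero_notMem_units d)]
  rw [h, Finset.prod_union (disjoint_units d),
    Finset.prod_image (fun i _ j _ h => eZ_injective d h),
    Finset.prod_image (fun i _ j _ h => eZ_injective d (neg_injective h)), Finset.prod_mul_distrib]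

/-- Balanced nearest neighbour transition probabilities. -/
structure IsBalanced {d : ℕ} (a : Zd d → Zd d → ℝ) : Prop where
  nonneg : ∀ x v, 0 ≤ a x v
  sum_eq_one : ∀ x, ∑ v ∈ Vfin d, a x v = 1
  bal : ∀ x i, a x (eZ d i) = a x (-eZ d i)

/-- One step average of `u` with respect to the transition probabilities `a`. -/
def stepAvg {d : ℕ} (a : Zd d → Zd d → ℝ) (u : Zd d → ℝ) (x : Zd d) : ℝ :=
  ∑ v ∈ Vfin d, a x v * u (x + v)

/-- `killedIter a B g k x` is the expectation of `g (X k)` on the event that the walk started at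
`x` has not left `B` up to time `k`. -/
def killedIter {d : ℕ} (a : Zd d → Zd d → ℝ) (B : Finset (Zd d)) (g : Zd d → ℝ) :
    ℕ → Zd d → ℝ
  | 0 => fun x => if x ∈ B then g x else 0
  | k + 1 => fun x => if x ∈ B then stepAvg a (killedIter a B g k) x else 0

lemma stepAvg_mono {d : ℕ} {a : Zd d → Zd d → ℝ} (ha : IsBalanced a) {u w : Zd d → ℝ}
    (h : ∀ x, u x ≤ w x) (x : Zd d) : stepAvg a u x ≤ stepAvg a w x :=
  Finset.sum_le_sum fun v _ => mul_le_mul_of_nonneg_left (h _) (ha.nonneg x v)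

lemma stepAvg_const {d : ℕ} {a : Zd d → Zd d → ℝ} (ha : IsBalanced a) (c : ℝ) (x : Zd d) :
    stepAvg a (fun _ => c) x = c := by
  rw [stepAvg, ← Finset.sum_mul, ha.sum_eq_one, one_mul]

lemma killedIter_of_notMem {d : ℕ} (a : Zd d → Zd d → ℝ) {B : Finset (Zd d)} (g : Zd d → ℝ)
    (k : ℕ) {x : Zd d} (hx : x ∉ B) : killedIter a B g k x = 0 := by
  cases k <;> simp [killedIter, hx]

lemma killedIter_mono {d : ℕ} {a : Zd d → Zd d → ℝ} (ha : IsBalanced a) (B : Finset (Zd d))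
    {g h : Zd d → ℝ} (hgh : ∀ x, g x ≤ h x) (k : ℕ) (x : Zd d) :
    killedIter a B g k x ≤ killedIter a B h k x := by
  induction k generalizing x with
  | zero => simp only [killedIter]; split_ifs <;> simp [hgh]
  | succ k ih => 
    simp only [killedIter]
    split_ifs
    · exact stepAvg_mono ha ih x
    · exact le_rfl

lemma killedIter_zero_fun {d : ℕ} (a : Zd d → Zd d → ℝ) (B : Finset (Zd d)) (k : ℕ) (x : Zd d) :
    killedIter a B (fun _ => 0) k x = 0 := by
  induction k generalizing x with
  | zero => simp [killedIter]
  | succ k ih => simp [killedIter, stepAvg, ih]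

lemma killedIter_nonneg {d : ℕ} {a : Zd d → Zd d → ℝ} (ha : IsBalanced a) (B : Finset (Zd d))
    {g : Zd d → ℝ} (hg : ∀ x, 0 ≤ g x) (k : ℕ) (x : Zd d) :
    0 ≤ killedIter a B g k x := by
  rw [← killedIter_zero_fun a B k x]
  exact killedIter_mono ha B hg k x

lemma killedIter_le_one {d : ℕ} {a : Zd d → Zd d → ℝ} (ha : IsBalanced a) (B : Finset (Zd d))
    {g : Zd d → ℝ} (hg : ∀ x, g x ≤ 1) (k : ℕ) (x : Zd d) :
    killedIter a B g k x ≤ 1 := by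
  induction k generalizing x with
  | zero => simp only [killedIter]; split_ifs <;> simp [hg]
  | succ k ih =>
    simp only [killedIter]
    split_ifs
    · exact (stepAvg_mono ha ih x).trans (stepAvg_const ha 1 x).le
    · exact zero_le_one

lemma killedIter_eq_sum {d : ℕ} (a : Zd d → Zd d → ℝ) (B : Finset (Zd d))
    (g : Zd d → ℝ) (k : ℕ) (x : Zd d) :
    killedIter a B g k x = ∑ y ∈ B, g y * killedIter a B (Pi.single y 1) k x := by
  induction k generalizing x with
  | zero =>
    simp only [killedIter]
    split_ifs with h
    · simp [Pi.single_apply, h]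
    · simp
  | succ k ih =>
    simp only [killedIter]
    split_ifs with h
    · simp only [stepAvg]
      simp_rw [Finset.mul_sum]
      rw [Finset.sum_comm]
      refine Finset.sum_congr rfl fun v _ => ?_
      rw [ih, Finset.mul_sum]
      refine Finset.sum_congr rfl fun y _ => ?_
      ring
    · simp

lemma killedIter_succ_le {d : ℕ} {a : Zd d → Zd d → ℝ} (ha : IsBalanced a) (B : Finset (Zd d))
    {g : Zd d → ℝ} (hg : ∀ x, 0 ≤ g x) (k : ℕ) (x : Zd d) :
    killedIter a B g (k + 1) x ≤ killedIter a B (stepAvg a g) k x := by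
  induction k generalizing x with
  | zero =>
    simp only [killedIter]
    split_ifs
    · refine stepAvg_mono ha (fun y => ?_) x
      split_ifs
      exacts [le_rfl, hg y]
    · exact le_rfl
  | succ k ih =>
    change (if x ∈ B then stepAvg a (killedIter a B g (k + 1)) x else 0) ≤
      (if x ∈ B then stepAvg a (killedIter a B (stepAvg a g) k) x else 0)
    split_ifs
    · exact stepAvg_mono ha ih x
    · exact le_rfl

/-- The killed walk is unlikely to leave the box before diffusive time. -/
lemma le_killedIter_one {d : ℕ} {a : Zd d → Zd d → ℝ} (ha : IsBalanced a) (R k : ℕ) (x : Zd d) :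
    1 - ((∑ i, (x i : ℝ) ^ 2) + k) / (R + 1 : ℝ) ^ 2 ≤
      killedIter a (latticeBox d R) (fun _ => 1) k x := by
  have hR : (0 : ℝ) < (R + 1 : ℝ) ^ 2 := by positivity
  have hout : ∀ (k : ℕ) (x : Zd d), x ∉ latticeBox d R →
      1 - ((∑ i, (x i : ℝ) ^ 2) + k) / (R + 1 : ℝ) ^ 2 ≤ 0 := by
    intro k x hx
    rw [mem_latticeBox] at hx
    push Not at hx
    obtain ⟨i, hi⟩ := hx
    rw [sub_nonpos, le_div_iff₀ hR, one_mul]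
    have h1 : (R + 1 : ℝ) ≤ |(x i : ℝ)| := by
      have : (R + 1 : ℤ) ≤ |x i| := hi
      exact_mod_cast this
    have h2 : (R + 1 : ℝ) ^ 2 ≤ (x i : ℝ) ^ 2 := by
      rw [← sq_abs (x i : ℝ)]; gcongr
    have h3 : (x i : ℝ) ^ 2 ≤ ∑ i, (x i : ℝ) ^ 2 :=
      Finset.single_le_sum (f := fun i => (x i : ℝ) ^ 2) (fun i _ => sq_nonneg _)
        (Finset.mem_univ i)
    have h4 : (0 : ℝ) ≤ k := k.cast_nonneg
    linarith
  induction k generalizing x with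
  | zero =>
    by_cases hx : x ∈ latticeBox d R
    · simp only [killedIter, hx, if_true, Nat.cast_zero, add_zero, tsub_le_iff_right]
      have : 0 ≤ (∑ i, (x i : ℝ) ^ 2) / (R + 1 : ℝ) ^ 2 :=
        div_nonneg (Finset.sum_nonneg fun i _ => sq_nonneg _) hR.le
      linarith
    · rw [killedIter_of_notMem _ _ _ hx]; exact hout _ _ hx
  | succ k ih =>
    by_cases hx : x ∈ latticeBox d R
    · simp only [killedIter, hx, if_true]
      refine le_trans ?_ (stepAvg_mono ha ih x)
      have hsq : ∀ v ∈ Vfin d, ∑ i, ((x + v) i : ℝ) ^ 2 ≤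
          ∑ i, (x i : ℝ) ^ 2 + 2 * ∑ i, (x i : ℝ) * v i + 1 := by
        intro v hv
        have hv1 : ∑ i, (v i : ℝ) ^ 2 ≤ 1 := by
          simp only [Vfin, Finset.mem_union, Finset.mem_image, Finset.mem_univ, true_and,
            Finset.mem_singleton] at hv
          rcases hv with (⟨i, rfl⟩ | ⟨i, rfl⟩) | rfl
          · simp [eZ, Pi.single_apply]
          · simp [eZ, Pi.single_apply]
          · simp
        have : ∑ i, ((x + v) i : ℝ) ^ 2 = ∑ i, (x i : ℝ) ^ 2 + 2 * ∑ i, (x i : ℝ) * v i +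
            ∑ i, (v i : ℝ) ^ 2 := by
          rw [Finset.mul_sum, ← Finset.sum_add_distrib, ← Finset.sum_add_distrib]
          refine Finset.sum_congr rfl fun i _ => ?_
          simp only [Pi.add_apply, Int.cast_add]; ring
        linarith
      have hlin : ∑ v ∈ Vfin d, a x v * ∑ i, (x i : ℝ) * v i = 0 := by
        rw [sum_Vfin]
        simp [ha.bal]
      have h2 : ∑ v ∈ Vfin d, a x v * ((∑ i, ((x + v) i : ℝ) ^ 2) + k) ≤
          (∑ i, (x i : ℝ) ^ 2) + (k + 1 : ℕ) := by
        calc _ ≤ ∑ v ∈ Vfin d, (a x v * ((∑ i, (x i : ℝ) ^ 2) + (k + 1 : ℕ)) +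
              2 * (a x v * ∑ i, (x i : ℝ) * v i)) := by
              refine Finset.sum_le_sum fun v hv => ?_
              have := mul_le_mul_of_nonneg_left (hsq v hv) (ha.nonneg x v)
              push_cast
              linarith
          _ = _ := by
              rw [Finset.sum_add_distrib, ← Finset.sum_mul, ← Finset.mul_sum, hlin,
                ha.sum_eq_one]
              ring
      have h3 : stepAvg a (fun y => 1 - ((∑ i, (y i : ℝ) ^ 2) + k) / (R + 1 : ℝ) ^ 2) x =
          1 - (∑ v ∈ Vfin d, a x v * ((∑ i, ((x + v) i : ℝ) ^ 2) + k)) / (R + 1 : ℝ) ^ 2 := by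
        simp only [stepAvg, mul_sub, mul_one, Finset.sum_sub_distrib, ha.sum_eq_one,
          Finset.sum_div, mul_div_assoc]
      rw [h3]
      gcongr
    · rw [killedIter_of_notMem _ _ _ hx]; exact hout _ _ hx

/-- The expected occupation functional of the walk killed outside of a box is controlled by the
`ℓ^d` norm of the weighted right-hand side. -/
lemma sum_killedIter_pow_le {d : ℕ} (hd : 1 ≤ d) {a : Zd d → Zd d → ℝ} (ha : IsBalanced a)
    (hpos : ∀ x i, 0 < a x (eZ d i)) (R n : ℕ) {g : Zd d → ℝ} (hg : ∀ x, 0 ≤ g x) :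
    (∑ k ∈ Finset.range n, killedIter a (latticeBox d R) g k 0) ^ d ≤
      ((R + 1) / 2 : ℝ) ^ d * ∑ x ∈ latticeBox d R, g x ^ d / ∏ i, a x (eZ d i) := by
  set u : Zd d → ℝ := fun x => ∑ k ∈ Finset.range n, killedIter a (latticeBox d R) g k x with hu
  refine discrete_abp hd R (fun x i => a x (eZ d i)) u g hpos (fun x hx => ?_) hg
    (fun x hx => ?_) (Finset.sum_nonneg fun k _ => killedIter_nonneg ha _ hg k 0)
  · simp [hu, killedIter_of_notMem _ _ _ hx]
  · have h1 : u x ≤ g x + stepAvg a u x := by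
      have h2 : u x ≤ ∑ k ∈ Finset.range (n + 1), killedIter a (latticeBox d R) g k x := by
        rw [Finset.sum_range_succ]
        exact le_add_of_nonneg_right (killedIter_nonneg ha _ hg n x)
      refine h2.trans (le_of_eq ?_)
      rw [Finset.sum_range_succ', add_comm]
      simp only [killedIter, hx, if_true, stepAvg, hu]
      rw [Finset.sum_comm]
      simp_rw [Finset.mul_sum]
    have h3 := ha.sum_eq_one x
    rw [sum_Vfin] at h3
    rw [stepAvg, sum_Vfin] at h1
    simp only [← ha.bal, add_zero, ← sub_eq_add_neg] at h1 h3
    have h4 : ∑ i, a x (eZ d i) * (2 * u x - u (x + eZ d i) - u (x - eZ d i)) =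
        (∑ i, (a x (eZ d i) + a x (eZ d i))) * u x -
        ∑ i, (a x (eZ d i) * u (x + eZ d i) + a x (eZ d i) * u (x - eZ d i)) := by
      rw [Finset.sum_mul, ← Finset.sum_sub_distrib]
      exact Finset.sum_congr rfl fun i _ => by ring
    rw [h4, eq_sub_of_add_eq h3]
    linarith

lemma isSetRing_measurableSet {Ω : Type*} [MeasurableSpace Ω] :
    IsSetRing {s : Set Ω | MeasurableSet s} where
  empty_mem := MeasurableSet.empty
  union_mem _ _ hs ht := hs.union ht
  sdiff_mem _ _ hs ht := hs.diff ht

/-- A sequence of sub-probability measures which is uniformly absolutely continuous with respect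
to a finite measure has a setwise limit along an ultrafilter. -/
theorem exists_setwise_limit {Ω : Type*} [MeasurableSpace Ω] (Q : ℕ → Measure Ω)
    (hQ : ∀ n, Q n Set.univ ≤ 1) (ν : Measure Ω) [IsFiniteMeasure ν] {d : ℕ} (hd : d ≠ 0)
    (hdom : ∀ n D, MeasurableSet D → Q n D ^ d ≤ ν D) :
    ∃ (F : Ultrafilter ℕ) (P : Measure Ω), (F : Filter ℕ) ≤ atTop ∧
      ∀ D, MeasurableSet D → Tendsto (fun n => Q n D) F (𝓝 (P D)) := by
  let F : Ultrafilter ℕ := hyperfilter ℕ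
  let m : Set Ω → ℝ≥0∞ := fun D => (F.map fun n => Q n D).lim
  have hm : ∀ D, Tendsto (fun n => Q n D) F (𝓝 (m D)) := fun D =>
    (F.map fun n => Q n D).le_nhds_lim
  have hm_empty : m ∅ = 0 := by
    refine tendsto_nhds_unique (hm ∅) ?_
    simp
  have hm_union : ∀ {s t : Set Ω}, s ∈ {s : Set Ω | MeasurableSet s} →
      t ∈ {s : Set Ω | MeasurableSet s} → Disjoint s t → m (s ∪ t) = m s + m t := by
    intro s t _ ht hst
    refine tendsto_nhds_unique (hm _) (((hm s).add (hm t)).congr fun n => ?_)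
    rw [measure_union hst ht]
  let c : AddContent ℝ≥0∞ {s : Set Ω | MeasurableSet s} :=
    isSetRing_measurableSet.addContent_of_union m hm_empty hm_union
  have hm_le : ∀ D, m D ≤ 1 := fun D =>
    le_of_tendsto (hm D) (Eventually.of_forall fun n => (measure_mono (Set.subset_univ D)).trans
      (hQ n))
  have hm_dom : ∀ D, MeasurableSet D → m D ^ d ≤ ν D := fun D hD =>
    le_of_tendsto (((ENNReal.continuous_pow d).tendsto _).comp (hm D))
      (Eventually.of_forall fun n => hdom n D hD)
  have hadd : ∀ ⦃f : ℕ → Set Ω⦄, (∀ i, MeasurableSet (f i)) →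
      Pairwise (Function.onFun Disjoint f) → m (⋃ i, f i) = ∑' i, m (f i) := fun f hf hdisj =>
    addContent_iUnion_eq_sum_of_tendsto_zero isSetRing_measurableSet c
    (fun s _ => ((hm_le s).trans_lt ENNReal.one_lt_top).ne) (fun s hs hanti hempty => by
      have h1 : Tendsto (fun n => ν (s n)) atTop (𝓝 0) := by
        have := tendsto_measure_iInter_atTop (μ := ν)
          (fun n => (hs n : MeasurableSet (s n)).nullMeasurableSet) hanti
          ⟨0, measure_ne_top _ _⟩
        rwa [hempty, measure_empty] at this
      have h2 : Tendsto (fun n => c (s n) ^ d) atTop (𝓝 0) :=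
        tendsto_of_tendsto_of_tendsto_of_le_of_le tendsto_const_nhds h1 (fun _ => zero_le)
          (fun n => hm_dom _ (hs n))
      have h3 := (ENNReal.continuous_rpow_const (y := (d : ℝ)⁻¹)).tendsto 0 |>.comp h2
      rw [ENNReal.zero_rpow_of_pos (by positivity)] at h3
      refine h3.congr fun n => ?_
      simp only [Function.comp, ← ENNReal.rpow_natCast]
      rw [← ENNReal.rpow_mul, mul_inv_cancel₀ (by exact_mod_cast hd), ENNReal.rpow_one])
      hf (MeasurableSet.iUnion hf) hdisj
  refine ⟨F, Measure.ofMeasurable (fun s _ => m s) hm_empty hadd, Nat.hyperfilter_le_atTop, ?_⟩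
  intro D hD
  rw [Measure.ofMeasurable_apply D hD]
  exact hm D

/-- Integrals of nonnegative functions are lower semicontinuous under setwise convergence. -/
lemma lintegral_le_of_setwise {Ω : Type*} [MeasurableSpace Ω] {Q : ℕ → Measure Ω}
    {P : Measure Ω} {F : Filter ℕ} [F.NeBot]
    (hP : ∀ D, MeasurableSet D → Tendsto (fun n => Q n D) F (𝓝 (P D)))
    {φ : Ω → ℝ≥0∞} {q : ℕ → ℝ≥0∞} {l : ℝ≥0∞} (hq : Tendsto q F (𝓝 l))
    (hle : ∀ n, ∫⁻ ω, φ ω ∂(Q n) ≤ q n) : ∫⁻ ω, φ ω ∂P ≤ l := by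
  rw [lintegral_eq_nnreal]
  refine iSup₂_le fun s hs => ?_
  have h : Tendsto (fun n => (s.map ((↑) : ℝ≥0 → ℝ≥0∞)).lintegral (Q n)) F
      (𝓝 ((s.map ((↑) : ℝ≥0 → ℝ≥0∞)).lintegral P)) := by
    simp only [SimpleFunc.map_lintegral]
    exact tendsto_finsetSum _ fun r _ =>
      ENNReal.Tendsto.const_mul (hP _ (s.measurableSet_fiber r)) (Or.inr ENNReal.coe_ne_top)
  refine le_of_tendsto_of_tendsto h hq (Eventually.of_forall fun n => ?_)
  refine le_trans ?_ (hle n)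
  exact (SimpleFunc.lintegral_eq_lintegral _ (Q n)).symm.trans_le (lintegral_mono hs)

/-- The transition probabilities of the walk in the environment `E ∘ ω`. -/
def envKer {d : ℕ} (E : Sd d → Sd d) (ω : Env d) : Zd d → Zd d → ℝ := fun x v => (E (ω x)).1 v

lemma isBalanced_envKer {d : ℕ} {E : Sd d → Sd d}
    (hbal : ∀ (ω : Env d) (x : Zd d) (i : Fin d),
      (E (ω x)).1 (eZ d i) = (E (ω x)).1 (-eZ d i)) (ω : Env d) : IsBalanced (envKer E ω) where
  nonneg x v := (E (ω x)).2.1 v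
  sum_eq_one x := (E (ω x)).2.2.2
  bal x i := hbal ω x i

lemma envKer_shiftE {d : ℕ} (E : Sd d → Sd d) (ω : Env d) (x y v : Zd d) :
    envKer E (shiftE x ω) y v = envKer E ω (x + y) v := rfl

lemma shiftE_shiftE {d : ℕ} (x y : Zd d) (ω : Env d) :
    shiftE y (shiftE x ω) = shiftE (x + y) ω := by
  ext z : 1
  simp [shiftE, add_assoc]

@[simp] lemma shiftE_zero {d : ℕ} (ω : Env d) : shiftE 0 ω = ω := by
  ext z : 1
  simp [shiftE]

@[fun_prop] lemma measurable_shiftE {d : ℕ} (x : Zd d) : Measurable (shiftE (d := d) x) :=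
  measurable_pi_lambda _ fun y => measurable_pi_apply (x + y)

lemma measurable_envKer {d : ℕ} {E : Sd d → Sd d} (hE : Measurable E) (x v : Zd d) :
    Measurable fun ω : Env d => envKer E ω x v :=
  (measurable_pi_apply v).comp (measurable_subtype_coe.comp (hE.comp (measurable_pi_apply x)))

lemma measurable_killedIter {d : ℕ} {E : Sd d → Sd d} (hE : Measurable E) (B : Finset (Zd d))
    {g : Env d → Zd d → ℝ} (hg : ∀ x, Measurable fun ω => g ω x) (k : ℕ) (x : Zd d) :
    Measurable fun ω : Env d => killedIter (envKer E ω) B (g ω) k x := by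
  induction k generalizing x with
  | zero =>
    simp only [killedIter]
    split_ifs
    exacts [hg x, measurable_const]
  | succ k ih =>
    simp only [killedIter]
    split_ifs
    · exact Finset.measurable_sum _ fun v _ => (measurable_envKer hE x v).mul (ih (x + v))
    · exact measurable_const

/-- Normalized expected occupation measure of the environment seen from the walk, which is killed
when it leaves the box of radius `2 * m`, up to time `m ^ 2`. -/
def occMeasure {d : ℕ} (μ : Measure (Env d)) (E : Sd d → Sd d) (m : ℕ) : Measure (Env d) :=
  ((m ^ 2 : ℕ) : ℝ≥0∞)⁻¹ • ∑ k ∈ Finset.range (m ^ 2), ∑ y ∈ latticeBox d (2 * m),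
    (μ.withDensity fun ω => ENNReal.ofReal
      (killedIter (envKer E ω) (latticeBox d (2 * m)) (Pi.single y 1) k 0)).map (shiftE y)

lemma lintegral_occMeasure {d : ℕ} (μ : Measure (Env d)) {E : Sd d → Sd d} (hE : Measurable E)
    (hbal : ∀ (ω : Env d) (x : Zd d) (i : Fin d),
      (E (ω x)).1 (eZ d i) = (E (ω x)).1 (-eZ d i)) (m : ℕ)
    {f : Env d → ℝ} (hf : Measurable f) (h0 : ∀ ω, 0 ≤ f ω) :
    ∫⁻ ω, ENNReal.ofReal (f ω) ∂(occMeasure μ E m) = ((m ^ 2 : ℕ) : ℝ≥0∞)⁻¹ *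
      ∫⁻ ω, ENNReal.ofReal (∑ k ∈ Finset.range (m ^ 2), killedIter (envKer E ω)
        (latticeBox d (2 * m)) (fun y => f (shiftE y ω)) k 0) ∂μ := by
  have hmeas : ∀ k y, Measurable fun ω : Env d => ENNReal.ofReal
      (killedIter (envKer E ω) (latticeBox d (2 * m)) (Pi.single y 1) k 0) := fun k y =>
    (measurable_killedIter (g := fun _ => Pi.single y 1) hE _
      (fun _ => measurable_const) k 0).ennreal_ofReal
  have hfm : ∀ y, Measurable fun ω => ENNReal.ofReal (f (shiftE y ω)) := fun y =>
    (hf.comp (measurable_shiftE y)).ennreal_ofReal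
  have hnn : ∀ (ω : Env d) (k : ℕ) (y : Zd d),
      0 ≤ killedIter (envKer E ω) (latticeBox d (2 * m)) (Pi.single y 1) k 0 := fun ω k y =>
    killedIter_nonneg (isBalanced_envKer hbal ω) _
      (fun z => by rw [Pi.single_apply]; split_ifs <;> simp) k 0
  have hrw : ∀ ω : Env d, ENNReal.ofReal (∑ k ∈ Finset.range (m ^ 2), killedIter (envKer E ω)
        (latticeBox d (2 * m)) (fun y => f (shiftE y ω)) k 0) =
      ∑ k ∈ Finset.range (m ^ 2), ∑ y ∈ latticeBox d (2 * m), ENNReal.ofReal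
        (killedIter (envKer E ω) (latticeBox d (2 * m)) (Pi.single y 1) k 0) *
          ENNReal.ofReal (f (shiftE y ω)) := by
    intro ω
    rw [ENNReal.ofReal_sum_of_nonneg fun k _ =>
      killedIter_nonneg (isBalanced_envKer hbal ω) _ (fun _ => h0 _) k 0]
    refine Finset.sum_congr rfl fun k _ => ?_
    rw [killedIter_eq_sum, ENNReal.ofReal_sum_of_nonneg fun y _ => mul_nonneg (h0 _) (hnn ω k y)]
    refine Finset.sum_congr rfl fun y _ => ?_
    rw [mul_comm, ENNReal.ofReal_mul (hnn ω k y)]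
  rw [occMeasure, lintegral_smul_measure, smul_eq_mul, lintegral_finsetSum_measure]
  simp_rw [hrw]
  have hprod : ∀ k y, Measurable fun ω : Env d => ENNReal.ofReal
      (killedIter (envKer E ω) (latticeBox d (2 * m)) (Pi.single y 1) k 0) *
        ENNReal.ofReal (f (shiftE y ω)) := fun k y => (hmeas k y).mul (hfm y)
  rw [lintegral_finsetSum _ fun k _ => Finset.measurable_sum _ fun y _ => hprod k y]
  congr 1
  refine Finset.sum_congr rfl fun k _ => ?_
  rw [lintegral_finsetSum_measure, lintegral_finsetSum _ fun y _ => hprod k y]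
  refine Finset.sum_congr rfl fun y _ => ?_
  rw [lintegral_map hf.ennreal_ofReal (measurable_shiftE y),
    lintegral_withDensity_eq_lintegral_mul _ (hmeas k y) (hfm y)]
  rfl

lemma occMeasure_apply {d : ℕ} (μ : Measure (Env d)) {E : Sd d → Sd d} (hE : Measurable E)
    (hbal : ∀ (ω : Env d) (x : Zd d) (i : Fin d),
      (E (ω x)).1 (eZ d i) = (E (ω x)).1 (-eZ d i)) (m : ℕ)
    {D : Set (Env d)} (hD : MeasurableSet D) :
    occMeasure μ E m D = ((m ^ 2 : ℕ) : ℝ≥0∞)⁻¹ *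
      ∫⁻ ω, ENNReal.ofReal (∑ k ∈ Finset.range (m ^ 2), killedIter (envKer E ω)
        (latticeBox d (2 * m)) (fun y => D.indicator (fun _ => (1 : ℝ)) (shiftE y ω)) k 0) ∂μ := by
  rw [← lintegral_occMeasure μ hE hbal m (measurable_const.indicator hD)
    fun ω => Set.indicator_nonneg (fun _ _ => zero_le_one) ω, ← lintegral_indicator_one hD]
  refine lintegral_congr fun ω => ?_
  by_cases h : ω ∈ D <;> simp [h]

lemma occMeasure_univ_le {d : ℕ} (μ : Measure (Env d)) [IsProbabilityMeasure μ] {E : Sd d → Sd d}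
    (hE : Measurable E) (hbal : ∀ (ω : Env d) (x : Zd d) (i : Fin d),
      (E (ω x)).1 (eZ d i) = (E (ω x)).1 (-eZ d i)) (m : ℕ) :
    occMeasure μ E m Set.univ ≤ 1 := by
  rw [occMeasure_apply μ hE hbal m MeasurableSet.univ]
  refine le_trans (mul_le_mul_right (lintegral_mono (g := fun _ => ((m ^ 2 : ℕ) : ℝ≥0∞))
    fun ω => ?_) _) ?_
  · rw [← ENNReal.ofReal_natCast]
    refine ENNReal.ofReal_le_ofReal ?_
    refine (Finset.sum_le_sum fun k _ => killedIter_le_one (isBalanced_envKer hbal ω) _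
      (fun x => by simp) k 0).trans (by simp)
  · simp only [lintegral_const, measure_univ, mul_one]
    exact ENNReal.inv_mul_le_one _

lemma le_occMeasure_univ {d : ℕ} (μ : Measure (Env d)) [IsProbabilityMeasure μ] {E : Sd d → Sd d}
    (hE : Measurable E) (hbal : ∀ (ω : Env d) (x : Zd d) (i : Fin d),
      (E (ω x)).1 (eZ d i) = (E (ω x)).1 (-eZ d i)) {m : ℕ} (hm : m ≠ 0) :
    2⁻¹ ≤ occMeasure μ E m Set.univ := by
  rw [occMeasure_apply μ hE hbal m MeasurableSet.univ]
  have hm' : (0 : ℝ) < m := by positivity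
  have hlow : ∀ ω : Env d, ((m ^ 2 : ℕ) : ℝ≥0∞) * 2⁻¹ ≤
      ENNReal.ofReal (∑ k ∈ Finset.range (m ^ 2), killedIter (envKer E ω)
        (latticeBox d (2 * m)) (fun y => Set.univ.indicator (fun _ => (1 : ℝ)) (shiftE y ω)) k 0)
      := by
    intro ω
    have h2 : ((m ^ 2 : ℕ) : ℝ≥0∞) * 2⁻¹ = ENNReal.ofReal (∑ k ∈ Finset.range (m ^ 2), 2⁻¹) := by
      rw [Finset.sum_const, Finset.card_range, nsmul_eq_mul, ENNReal.ofReal_mul (by positivity),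
        ENNReal.ofReal_natCast, ENNReal.ofReal_inv_of_pos two_pos, ENNReal.ofReal_ofNat]
    rw [h2]
    refine ENNReal.ofReal_le_ofReal (Finset.sum_le_sum fun k hk => ?_)
    simp only [Set.indicator_univ]
    refine le_trans ?_ (le_killedIter_one (isBalanced_envKer hbal ω) (2 * m) k 0)
    have hk' : (k : ℝ) ≤ m ^ 2 := by
      exact_mod_cast (Finset.mem_range.1 hk).le
    have : ((∑ i : Fin d, (((0 : Zd d) i : ℤ) : ℝ) ^ 2) + k) / (((2 * m : ℕ) : ℝ) + 1) ^ 2 ≤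
        2⁻¹ := by
      rw [div_le_iff₀ (by positivity)]
      push_cast
      simp
      nlinarith
    linarith
  calc (2⁻¹ : ℝ≥0∞) = ((m ^ 2 : ℕ) : ℝ≥0∞)⁻¹ * (((m ^ 2 : ℕ) : ℝ≥0∞) * 2⁻¹) := by
        rw [← mul_assoc, ENNReal.inv_mul_cancel (by positivity) (ENNReal.natCast_ne_top _), one_mul]
    _ = ((m ^ 2 : ℕ) : ℝ≥0∞)⁻¹ * ∫⁻ _ω, ((m ^ 2 : ℕ) : ℝ≥0∞) * 2⁻¹ ∂μ := by simp
    _ ≤ _ := mul_le_mul_right (lintegral_mono hlow) _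

/-- Approximate invariance of the occupation measures. -/
lemma lintegral_occMeasure_step_le {d : ℕ} (μ : Measure (Env d)) [IsProbabilityMeasure μ]
    {E : Sd d → Sd d} (hE : Measurable E) (hbal : ∀ (ω : Env d) (x : Zd d) (i : Fin d),
      (E (ω x)).1 (eZ d i) = (E (ω x)).1 (-eZ d i)) {m : ℕ}
    {D : Set (Env d)} (hD : MeasurableSet D) :
    ∫⁻ ω, ENNReal.ofReal (∑ v ∈ Vfin d, envKer E ω 0 v *
        D.indicator (fun _ => (1 : ℝ)) (shiftE v ω)) ∂(occMeasure μ E m) ≤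
      occMeasure μ E m D + ((m ^ 2 : ℕ) : ℝ≥0∞)⁻¹ := by
  have hmD : Measurable (D.indicator (fun _ => (1 : ℝ))) := measurable_const.indicator hD
  have hD0 : ∀ ω, 0 ≤ D.indicator (fun _ => (1 : ℝ)) ω := fun ω =>
    Set.indicator_nonneg (fun _ _ => zero_le_one) ω
  have hD1 : ∀ ω, D.indicator (fun _ => (1 : ℝ)) ω ≤ 1 := fun ω =>
    Set.indicator_le_self' (f := fun _ => (1 : ℝ)) (fun _ _ => zero_le_one) ω
  have hPf : Measurable fun ω : Env d => ∑ v ∈ Vfin d, envKer E ω 0 v *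
      D.indicator (fun _ => (1 : ℝ)) (shiftE v ω) := Finset.measurable_sum _ fun v _ =>
    (measurable_envKer hE 0 v).mul (hmD.comp (measurable_shiftE v))
  rw [lintegral_occMeasure μ hE hbal m hPf fun ω =>
    Finset.sum_nonneg fun v _ => mul_nonneg ((isBalanced_envKer hbal ω).nonneg 0 v) (hD0 _),
    occMeasure_apply μ hE hbal m hD]
  have key : ∀ ω : Env d, ENNReal.ofReal (∑ k ∈ Finset.range (m ^ 2), killedIter (envKer E ω)
      (latticeBox d (2 * m)) (fun y => ∑ v ∈ Vfin d, envKer E (shiftE y ω) 0 v *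
        D.indicator (fun _ => (1 : ℝ)) (shiftE v (shiftE y ω))) k 0) ≤
      ENNReal.ofReal (∑ k ∈ Finset.range (m ^ 2), killedIter (envKer E ω)
        (latticeBox d (2 * m)) (fun y => D.indicator (fun _ => (1 : ℝ)) (shiftE y ω)) k 0) + 1 := by
    intro ω
    have ha := isBalanced_envKer hbal ω
    set g : Zd d → ℝ := fun y => D.indicator (fun _ => (1 : ℝ)) (shiftE y ω) with hg
    have hstep : (fun y => ∑ v ∈ Vfin d, envKer E (shiftE y ω) 0 v *
        D.indicator (fun _ => (1 : ℝ)) (shiftE v (shiftE y ω))) = stepAvg (envKer E ω) g := by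
      funext y
      simp only [stepAvg, hg, shiftE_shiftE, envKer_shiftE, add_zero]
    rw [hstep, ← ENNReal.ofReal_one, ← ENNReal.ofReal_add (Finset.sum_nonneg fun k _ =>
      killedIter_nonneg ha _ (fun _ => hD0 _) k 0) zero_le_one]
    refine ENNReal.ofReal_le_ofReal ?_
    have hcompl : ∀ k, killedIter (envKer E ω) (latticeBox d (2 * m)) (fun y => 1 - g y) (k + 1) 0 ≤
        killedIter (envKer E ω) (latticeBox d (2 * m)) (fun _ => 1) k 0 -
        killedIter (envKer E ω) (latticeBox d (2 * m)) (stepAvg (envKer E ω) g) k 0 := by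
      intro k
      refine (killedIter_succ_le ha _ (fun y => sub_nonneg.2 (hD1 _)) k 0).trans (le_of_eq ?_)
      have : stepAvg (envKer E ω) (fun y => 1 - g y) = fun y => 1 - stepAvg (envKer E ω) g y := by
        funext y
        simp only [stepAvg, mul_sub, mul_one, Finset.sum_sub_distrib, ha.sum_eq_one]
      rw [this, killedIter_eq_sum, killedIter_eq_sum _ _ (fun _ => 1),
        killedIter_eq_sum _ _ (stepAvg _ _), ← Finset.sum_sub_distrib]
      exact Finset.sum_congr rfl fun y _ => by ring
    have hsub : ∀ k, killedIter (envKer E ω) (latticeBox d (2 * m)) (fun y => 1 - g y) k 0 =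
        killedIter (envKer E ω) (latticeBox d (2 * m)) (fun _ => 1) k 0 -
        killedIter (envKer E ω) (latticeBox d (2 * m)) g k 0 := by
      intro k
      rw [killedIter_eq_sum, killedIter_eq_sum _ _ (fun _ => 1), killedIter_eq_sum _ _ g,
        ← Finset.sum_sub_distrib]
      exact Finset.sum_congr rfl fun y _ => by ring
    have h1 := Finset.sum_le_sum fun k (_ : k ∈ Finset.range (m ^ 2)) => hcompl k
    have h2 := Finset.sum_range_succ' (fun k =>
      killedIter (envKer E ω) (latticeBox d (2 * m)) (fun y => 1 - g y) k 0) (m ^ 2)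
    rw [Finset.sum_range_succ] at h2
    have h3 := killedIter_nonneg ha (latticeBox d (2 * m)) (fun y => sub_nonneg.2 (hD1 (shiftE y ω)))
      (m ^ 2) 0
    have h4 := killedIter_le_one ha (latticeBox d (2 * m))
      (g := fun y => 1 - g y) (fun y => sub_le_self 1 (hD0 (shiftE y ω))) 0 0
    have h5 := Finset.sum_congr rfl fun k (_ : k ∈ Finset.range (m ^ 2)) => hsub k
    rw [Finset.sum_sub_distrib] at h1 h5
    change 0 ≤ killedIter (envKer E ω) (latticeBox d (2 * m)) (fun y => 1 - g y) (m ^ 2) 0 at h3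
    linarith
  refine (mul_le_mul_right (lintegral_mono key) _).trans ?_
  rw [lintegral_add_right _ measurable_const, lintegral_const, measure_univ, mul_add]
  simp

/-- Jensen's inequality for powers. -/
lemma lintegral_pow_le {Ω : Type*} [MeasurableSpace Ω] (μ : Measure Ω) [IsProbabilityMeasure μ]
    {d : ℕ} (hd : 1 ≤ d) {f : Ω → ℝ≥0∞} (hf : Measurable f) :
    (∫⁻ ω, f ω ∂μ) ^ d ≤ ∫⁻ ω, f ω ^ d ∂μ := by
  have h := eLpNorm'_le_eLpNorm'_of_exponent_le (p := 1) (q := d) one_pos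
    (by exact_mod_cast hd) μ hf.aestronglyMeasurable
  simp only [eLpNorm', enorm_eq_self, ENNReal.rpow_one, ENNReal.rpow_natCast, div_one] at h
  refine (pow_le_pow_left' h d).trans (le_of_eq ?_)
  rw [← ENNReal.rpow_natCast, ← ENNReal.rpow_mul, one_div, inv_mul_cancel₀ (by positivity),
    ENNReal.rpow_one]

/-- The occupation measures are uniformly absolutely continuous. -/
lemma occMeasure_pow_le {d : ℕ} (hd : 1 ≤ d) (μ : Measure (Env d)) [IsProbabilityMeasure μ]
    (hstat : ∀ x : Zd d, Measure.map (shiftE x) μ = μ) {E : Sd d → Sd d} (hE : Measurable E)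
    (hbal : ∀ (ω : Env d) (x : Zd d) (i : Fin d),
      (E (ω x)).1 (eZ d i) = (E (ω x)).1 (-eZ d i))
    (hell : ∀ᵐ ω ∂μ, ∀ x : Zd d, ∀ v ∈ Vfin d, v ≠ 0 → 0 < (E (ω x)).1 v)
    {m : ℕ} (hm : m ≠ 0) {D : Set (Env d)} (hD : MeasurableSet D) :
    occMeasure μ E m D ^ d ≤ 8 ^ d *
      ∫⁻ ω in D, ENNReal.ofReal (1 / ∏ i, envKer E ω 0 (eZ d i)) ∂μ := by
  set R := 2 * m with hR
  have hmD : Measurable (D.indicator (fun _ => (1 : ℝ))) := measurable_const.indicator hD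
  have hD0 : ∀ ω, 0 ≤ D.indicator (fun _ => (1 : ℝ)) ω := fun ω =>
    Set.indicator_nonneg (fun _ _ => zero_le_one) ω
  have hm' : (1 : ℝ) ≤ m := by exact_mod_cast Nat.one_le_iff_ne_zero.2 hm
  set W : Env d → ℝ≥0∞ := fun ω => D.indicator (fun ω =>
    ENNReal.ofReal (1 / ∏ i, envKer E ω 0 (eZ d i))) ω with hW
  have hWm : Measurable W :=
    (measurable_const.div (Finset.measurable_prod _ fun i _ =>
      measurable_envKer hE 0 _)).ennreal_ofReal.indicator hD
  have hpt : ∀ᵐ ω ∂μ, ENNReal.ofReal (∑ k ∈ Finset.range (m ^ 2), killedIter (envKer E ω)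
      (latticeBox d R) (fun y => D.indicator (fun _ => (1 : ℝ)) (shiftE y ω)) k 0) ^ d ≤
      ENNReal.ofReal (((R + 1) / 2 : ℝ) ^ d) * ∑ x ∈ latticeBox d R, W (shiftE x ω) := by
    filter_upwards [hell] with ω hω
    have ha := isBalanced_envKer hbal ω
    have hpos : ∀ x i, 0 < envKer E ω x (eZ d i) := fun x i =>
      hω x _ (eZ_mem_Vfin i) (eZ_ne_zero i)
    rw [← ENNReal.ofReal_pow (Finset.sum_nonneg fun k _ => killedIter_nonneg ha _
      (fun _ => hD0 _) k 0)]
    refine (ENNReal.ofReal_le_ofReal (sum_killedIter_pow_le hd ha hpos R (m ^ 2)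
      (fun y => hD0 (shiftE y ω)))).trans (le_of_eq ?_)
    rw [ENNReal.ofReal_mul (by positivity), ENNReal.ofReal_sum_of_nonneg fun x _ =>
      div_nonneg (pow_nonneg (hD0 _) _) (Finset.prod_nonneg fun i _ => (hpos x i).le)]
    congr 1
    refine Finset.sum_congr rfl fun x _ => ?_
    by_cases h : shiftE x ω ∈ D
    · simp [hW, h, envKer_shiftE]
    · simp [hW, h, show d ≠ 0 by omega]
  have hWshift : ∀ x, ∫⁻ ω, W (shiftE x ω) ∂μ = ∫⁻ ω, W ω ∂μ := fun x => by
    rw [← lintegral_map hWm (measurable_shiftE x), hstat]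
  rw [occMeasure_apply μ hE hbal m hD, mul_pow, ← lintegral_indicator hD]
  have hmeas : Measurable fun ω => ENNReal.ofReal (∑ k ∈ Finset.range (m ^ 2),
      killedIter (envKer E ω) (latticeBox d R)
        (fun y => D.indicator (fun _ => (1 : ℝ)) (shiftE y ω)) k 0) :=
    (Finset.measurable_sum _ fun k _ =>
      measurable_killedIter hE _ (fun y => hmD.comp (measurable_shiftE y)) k 0).ennreal_ofReal
  refine (mul_le_mul_right ((lintegral_pow_le μ hd hmeas).trans (lintegral_mono_ae hpt)) _).trans ?_
  have hWc : ∀ x, Measurable fun ω => W (shiftE x ω) := fun x => hWm.comp (measurable_shiftE x)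
  rw [lintegral_const_mul _ (Finset.measurable_sum _ fun x _ => hWc x),
    lintegral_finsetSum _ fun x _ => hWc x]
  simp_rw [hWshift]
  rw [Finset.sum_const, card_latticeBox, nsmul_eq_mul, ← mul_assoc, ← mul_assoc]
  refine mul_le_mul_left ?_ _
  rw [ENNReal.ofReal_pow (by positivity), ← mul_pow, Nat.cast_pow (2 * R + 1), ← mul_pow]
  refine pow_le_pow_left' ?_ d
  rw [← ENNReal.ofReal_natCast, ← ENNReal.ofReal_inv_of_pos (by positivity),
    ← ENNReal.ofReal_mul (by positivity), ← ENNReal.ofReal_natCast,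
    ← ENNReal.ofReal_mul (by positivity), show (8 : ℝ≥0∞) = ENNReal.ofReal 8 by simp]
  refine ENNReal.ofReal_le_ofReal ?_
  rw [mul_assoc, inv_mul_le_iff₀ (by positivity), hR]
  push_cast
  nlinarith

/-- One step of the environment seen from the walk. -/
def envStep {d : ℕ} (E : Sd d → Sd d) (P : Measure (Env d)) : Measure (Env d) :=
  ∑ v ∈ Vfin d, (P.withDensity fun ω => ENNReal.ofReal (envKer E ω 0 v)).map (shiftE v)

lemma lintegral_envStep {d : ℕ} {E : Sd d → Sd d} (hE : Measurable E) (P : Measure (Env d))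
    {f : Env d → ℝ≥0∞} (hf : Measurable f) :
    ∫⁻ ω, f ω ∂(envStep E P) =
      ∫⁻ ω, ∑ v ∈ Vfin d, ENNReal.ofReal (envKer E ω 0 v) * f (shiftE v ω) ∂P := by
  have hm : ∀ v, Measurable fun ω : Env d => ENNReal.ofReal (envKer E ω 0 v) := fun v =>
    (measurable_envKer hE 0 v).ennreal_ofReal
  have hfs : ∀ v, Measurable fun ω => f (shiftE v ω) := fun v => hf.comp (measurable_shiftE v)
  have hp : ∀ v, Measurable fun ω : Env d =>
      ENNReal.ofReal (envKer E ω 0 v) * f (shiftE v ω) := fun v => (hm v).mul (hfs v)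
  rw [envStep, lintegral_finsetSum_measure, lintegral_finsetSum _ fun v _ => hp v]
  refine Finset.sum_congr rfl fun v _ => ?_
  rw [lintegral_map hf (measurable_shiftE v),
    lintegral_withDensity_eq_lintegral_mul _ (hm v) (hfs v)]
  rfl

lemma envKer_nonneg {d : ℕ} (E : Sd d → Sd d) (ω : Env d) (x v : Zd d) : 0 ≤ envKer E ω x v :=
  (E (ω x)).2.1 v

lemma sum_ofReal_envKer {d : ℕ} (E : Sd d → Sd d) (ω : Env d) (x : Zd d) :
    ∑ v ∈ Vfin d, ENNReal.ofReal (envKer E ω x v) = 1 := by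
  rw [← ENNReal.ofReal_sum_of_nonneg fun v _ => envKer_nonneg E ω x v, ← ENNReal.ofReal_one]
  exact congrArg _ (E (ω x)).2.2.2

lemma envStep_univ {d : ℕ} {E : Sd d → Sd d} (hE : Measurable E) (P : Measure (Env d)) :
    envStep E P Set.univ = P Set.univ := by
  rw [← lintegral_one, lintegral_envStep hE P measurable_const]
  simp [sum_ofReal_envKer]

lemma one_div_prod_le {d : ℕ} (hd : 1 ≤ d) {E : Sd d → Sd d}
    (hbal : ∀ (ω : Env d) (x : Zd d) (i : Fin d),
      (E (ω x)).1 (eZ d i) = (E (ω x)).1 (-eZ d i)) {p : ℝ} (hp : (d : ℝ) < p) {ω : Env d}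
    (hω : ∀ x : Zd d, ∀ v ∈ Vfin d, v ≠ 0 → 0 < (E (ω x)).1 v) :
    1 / ∏ i, envKer E ω 0 (eZ d i) ≤ cE d E ω 0 ^ (-p) := by
  have hpos : ∀ i, 0 < envKer E ω 0 (eZ d i) := fun i => hω 0 _ (eZ_mem_Vfin i) (eZ_ne_zero i)
  have hle : ∀ i, envKer E ω 0 (eZ d i) ≤ 1 := fun i => by
    have h := Finset.single_le_sum (f := fun v => (E (ω 0)).1 v)
      (fun v _ => (E (ω 0)).2.1 v) (eZ_mem_Vfin i)
    exact h.trans (E (ω 0)).2.2.2.le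
  set q := ∏ i, envKer E ω 0 (eZ d i) with hq
  have hq0 : 0 < q := Finset.prod_pos fun i _ => hpos i
  have hq1 : q ≤ 1 := Finset.prod_le_one (fun i _ => (hpos i).le) fun i _ => hle i
  have hd0 : (0 : ℝ) < d := by exact_mod_cast hd
  have hc : cE d E ω 0 = q ^ (d : ℝ)⁻¹ := by
    rw [cE, prod_Vfin_erase]
    have : ∀ i, (E (ω 0)).1 (eZ d i) * (E (ω 0)).1 (-eZ d i) = envKer E ω 0 (eZ d i) ^ 2 :=
      fun i => by rw [← hbal, sq]; rfl
    rw [Finset.prod_congr rfl fun i _ => this i, Finset.prod_pow, ← hq, ← Real.rpow_natCast,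
      ← Real.rpow_mul hq0.le]
    congr 1
    push_cast
    field_simp
  rw [hc, ← Real.rpow_mul hq0.le, one_div, ← Real.rpow_neg_one]
  refine Real.rpow_le_rpow_of_exponent_ge hq0 hq1 ?_
  rw [mul_neg, neg_le_neg_iff, inv_mul_eq_div, one_le_div hd0]
  exact hp.le

/-- Existence of an absolutely continuous invariant probability measure for the environment seen
from the walk. -/
lemma exists_envStep_eq {d : ℕ} (hd : 1 ≤ d) (μ : Measure (Env d)) [IsProbabilityMeasure μ]
    (hstat : ∀ x : Zd d, Measure.map (shiftE x) μ = μ) {E : Sd d → Sd d} (hE : Measurable E)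
    (hbal : ∀ (ω : Env d) (x : Zd d) (i : Fin d),
      (E (ω x)).1 (eZ d i) = (E (ω x)).1 (-eZ d i))
    (hell : ∀ᵐ ω ∂μ, ∀ x : Zd d, ∀ v ∈ Vfin d, v ≠ 0 → 0 < (E (ω x)).1 v)
    (hmom : ∃ p : ℝ, (d : ℝ) < p ∧ ∫⁻ ω, ENNReal.ofReal (cE d E ω 0 ^ (-p)) ∂μ < ⊤) :
    ∃ Q : Measure (Env d), IsProbabilityMeasure Q ∧ Q ≪ μ ∧ envStep E Q = Q := by
  obtain ⟨p, hp, hfin⟩ := hmom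
  set w : Env d → ℝ≥0∞ := fun ω => ENNReal.ofReal (1 / ∏ i, envKer E ω 0 (eZ d i)) with hw
  have hwfin : ∫⁻ ω, w ω ∂μ ≠ ∞ := by
    refine ne_top_of_le_ne_top hfin.ne (lintegral_mono_ae ?_)
    filter_upwards [hell] with ω hω
    exact ENNReal.ofReal_le_ofReal (one_div_prod_le hd hbal hp hω)
  set ν : Measure (Env d) := (8 ^ d : ℝ≥0∞) • μ.withDensity w with hν
  have : IsFiniteMeasure (μ.withDensity w) := isFiniteMeasure_withDensity hwfin
  have : IsFiniteMeasure ν := Measure.smul_finite _ (by finiteness)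
  have hνμ : ν ≪ μ := (withDensity_absolutelyContinuous μ w).smul_left _
  obtain ⟨F, P, hF, hP⟩ := exists_setwise_limit (fun n => occMeasure μ E (n + 1))
    (fun n => occMeasure_univ_le μ hE hbal (n + 1)) ν (d := d) (by omega) fun n D hD => by
      rw [hν, Measure.smul_apply, withDensity_apply _ hD, smul_eq_mul]
      exact occMeasure_pow_le hd μ hstat hE hbal hell n.succ_ne_zero hD
  have hPu : P Set.univ ≤ 1 := le_of_tendsto' (hP _ MeasurableSet.univ) fun n =>
    occMeasure_univ_le μ hE hbal (n + 1)
  have hPl : 2⁻¹ ≤ P Set.univ := ge_of_tendsto' (hP _ MeasurableSet.univ) fun n =>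
    le_occMeasure_univ μ hE hbal n.succ_ne_zero
  have : IsFiniteMeasure P := ⟨hPu.trans_lt ENNReal.one_lt_top⟩
  have hPμ : P ≪ μ := by
    refine Measure.AbsolutelyContinuous.mk fun D hD h0 => ?_
    have h1 : P D ^ d ≤ ν D := le_of_tendsto' (((ENNReal.continuous_pow d).tendsto _).comp
      (hP D hD)) fun n => by
        rw [hν, Measure.smul_apply, withDensity_apply _ hD, smul_eq_mul]
        exact occMeasure_pow_le hd μ hstat hE hbal hell n.succ_ne_zero hD
    rw [hνμ h0, nonpos_iff_eq_zero] at h1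
    exact pow_eq_zero_iff (by omega) |>.1 h1
  have hinvD : ∀ D, MeasurableSet D → envStep E P D ≤ P D := by
    intro D hD
    rw [← lintegral_indicator_one hD, lintegral_envStep hE P (measurable_one.indicator hD)]
    have hz : Tendsto (fun n : ℕ => (((n + 1) ^ 2 : ℕ) : ℝ≥0∞)⁻¹) F (𝓝 0) := by
      refine Tendsto.mono_left ?_ hF
      refine ENNReal.tendsto_inv_nat_nhds_zero.comp (tendsto_atTop_mono (fun n => ?_) tendsto_id)
      simp only [id]
      nlinarith
    have := lintegral_le_of_setwise hP (by simpa using (hP D hD).add hz) fun n =>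
      lintegral_occMeasure_step_le (m := n + 1) μ hE hbal hD
    refine le_trans (le_of_eq (lintegral_congr fun ω => ?_)) this
    rw [ENNReal.ofReal_sum_of_nonneg fun v _ => mul_nonneg (envKer_nonneg E ω 0 v)
      (Set.indicator_nonneg (fun _ _ => zero_le_one) _)]
    refine Finset.sum_congr rfl fun v _ => ?_
    by_cases h : shiftE v ω ∈ D <;> simp [h]
  have : IsFiniteMeasure (envStep E P) := ⟨by
    rw [envStep_univ hE P]
    exact measure_lt_top P _⟩
  have hinv : envStep E P = P :=
    Measure.eq_of_le_of_measure_univ_eq (Measure.le_iff.2 hinvD) (envStep_univ hE P)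
  have hP0 : P Set.univ ≠ 0 := (lt_of_lt_of_le (by simp) hPl).ne'
  refine ⟨(P Set.univ)⁻¹ • P, ⟨?_⟩, hPμ.smul_left _, ?_⟩
  · rw [Measure.smul_apply, smul_eq_mul, ENNReal.inv_mul_cancel hP0 (measure_ne_top _ _)]
  · ext D hD
    rw [← lintegral_indicator_one hD, lintegral_envStep hE _ (measurable_one.indicator hD),
      lintegral_smul_measure, ← lintegral_envStep hE _ (measurable_one.indicator hD), hinv,
      lintegral_indicator_one hD]
    rfl

lemma measurePreserving_shiftE {d : ℕ} {μ : Measure (Env d)}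
    (hstat : ∀ x : Zd d, Measure.map (shiftE x) μ = μ) (x : Zd d) :
    MeasurePreserving (shiftE x) μ μ := ⟨measurable_shiftE x, hstat x⟩

/-- Almost sure invariance under the generators implies invariance under all shifts. -/
lemma ae_shiftE_eq {d : ℕ} {μ : Measure (Env d)}
    (hstat : ∀ x : Zd d, Measure.map (shiftE x) μ = μ) {α : Type*} {f : Env d → α}
    (hf : ∀ i, ∀ᵐ ω ∂μ, f (shiftE (eZ d i) ω) = f ω) (x : Zd d) :
    ∀ᵐ ω ∂μ, f (shiftE x ω) = f ω := by
  let S : AddSubgroup (Zd d) :=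
    { carrier := {x | ∀ᵐ ω ∂μ, f (shiftE x ω) = f ω}
      zero_mem' := by simp
      add_mem' := fun {x y} hx hy => by
        filter_upwards [hx, (measurePreserving_shiftE hstat x).quasiMeasurePreserving.ae hy]
          with ω h1 h2
        rw [← shiftE_shiftE, h2, h1]
      neg_mem' := fun {x} hx => by
        filter_upwards [(measurePreserving_shiftE hstat (-x)).quasiMeasurePreserving.ae hx]
          with ω h1
        rw [shiftE_shiftE, neg_add_cancel, shiftE_zero] at h1
        exact h1.symm }
  have hx : x = ∑ i, x i • eZ d i := by
    rw [← Finset.univ_sum_single x]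
    refine Finset.sum_congr rfl fun i _ => ?_
    rw [eZ, ← Pi.single_smul]
    simp
  change x ∈ S
  rw [hx]
  exact S.sum_mem fun i _ => S.zsmul_mem (hf i) _

/-- Almost surely invariant sets are trivial. -/
lemma measure_eq_zero_or_ae_mem {d : ℕ} {μ : Measure (Env d)} [IsProbabilityMeasure μ]
    (hμ : StationaryErgodic μ) {D : Set (Env d)} (hD : MeasurableSet D)
    (hinv : ∀ i, ∀ᵐ ω ∂μ, (shiftE (eZ d i) ω ∈ D) = (ω ∈ D)) :
    μ D = 0 ∨ ∀ᵐ ω ∂μ, ω ∈ D := by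
  have hall : ∀ᵐ ω ∂μ, ∀ x, (shiftE x ω ∈ D) = (ω ∈ D) :=
    ae_all_iff.2 fun x => ae_shiftE_eq hμ.1 (f := fun ω => ω ∈ D) hinv x
  set D' : Set (Env d) := ⋂ x, shiftE x ⁻¹' D with hD'
  have hD'm : MeasurableSet D' := MeasurableSet.iInter fun x => measurable_shiftE x hD
  have heq : ∀ᵐ ω ∂μ, ω ∈ D' ↔ ω ∈ D := by
    filter_upwards [hall] with ω hω
    simp [hD', hω]
  have hs : ∀ x : Zd d, shiftE x ⁻¹' D' = D' := by
    intro x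
    ext ω
    simp only [hD', Set.mem_preimage, Set.mem_iInter, shiftE_shiftE]
    exact ⟨fun h y => by simpa using h (y - x), fun h y => h (x + y)⟩
  rcases hμ.2 D' hD'm hs with h | h
  · left
    rw [← h]
    exact measure_congr (heq.mono fun ω h => propext h.symm)
  · right
    filter_upwards [heq, (prob_compl_eq_zero_iff hD'm).2 h |> compl_mem_ae_iff.2] with ω h1 h2
    exact h1.1 (by simpa using h2)

/-- Almost surely invariant functions are constant. -/
lemma exists_ae_eq_const {d : ℕ} {μ : Measure (Env d)} [IsProbabilityMeasure μ]
    (hμ : StationaryErgodic μ) {f : Env d → ℝ} (hf : Measurable f)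
    (hinv : ∀ i, ∀ᵐ ω ∂μ, f (shiftE (eZ d i) ω) = f ω) : ∃ a, ∀ᵐ ω ∂μ, f ω = a := by
  refine exists_eventuallyEq_const_of_forall_separating MeasurableSet fun U hU => ?_
  rcases measure_eq_zero_or_ae_mem hμ (hf hU) fun i => (hinv i).mono fun ω hω => by
    simp only [Set.mem_preimage, hω] with h | h
  · exact Or.inr (measure_eq_zero_iff_ae_notMem.1 h)
  · exact Or.inl h

/-- An absolutely continuous invariant measure is equivalent to the law of the environment. -/
lemma absolutelyContinuous_of_envStep_eq {d : ℕ} {μ Q : Measure (Env d)} [IsProbabilityMeasure μ]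
    [IsProbabilityMeasure Q] (hμ : StationaryErgodic μ) {E : Sd d → Sd d} (hE : Measurable E)
    (hell : ∀ᵐ ω ∂μ, ∀ x : Zd d, ∀ v ∈ Vfin d, v ≠ 0 → 0 < (E (ω x)).1 v)
    (hQμ : Q ≪ μ) (hQ : envStep E Q = Q) : μ ≪ Q := by
  have hQd := Measure.withDensity_rnDeriv_eq Q μ hQμ
  have hrm := Measure.measurable_rnDeriv Q μ
  set ρ := Q.rnDeriv μ with hρ
  set N : Set (Env d) := {ω | ρ ω = 0} with hN
  have hNm : MeasurableSet N := hrm (measurableSet_singleton 0)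
  have hQN : Q N = 0 := by
    rw [← hQd, withDensity_apply_eq_zero hrm]
    convert measure_empty (μ := μ)
    ext ω
    simp [hN]
  have hae : ∀ p : Env d → Prop, (∀ᵐ ω ∂Q, p ω) → ∀ᵐ ω ∂μ, ω ∉ N → p ω := by
    intro p hp
    rw [← hQd, ae_withDensity_iff hrm] at hp
    exact hp
  have hstep : ∀ᵐ ω ∂Q, ∀ v ∈ Vfin d, v ≠ 0 → shiftE v ω ∉ N := by
    have h0 : ∫⁻ ω, N.indicator 1 ω ∂(envStep E Q) = 0 := by
      rw [hQ, lintegral_indicator_one hNm, hQN]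
    have hmi : Measurable fun ω => ∑ v ∈ Vfin d, ENNReal.ofReal (envKer E ω 0 v) *
        N.indicator (1 : Env d → ℝ≥0∞) (shiftE v ω) :=
      Finset.measurable_sum _ fun v _ => (measurable_envKer hE 0 v).ennreal_ofReal.mul
        ((measurable_one.indicator hNm).comp (measurable_shiftE v))
    rw [lintegral_envStep hE Q (measurable_one.indicator hNm), lintegral_eq_zero_iff hmi] at h0
    filter_upwards [h0, hQμ.ae_le hell] with ω h1 h2 v hv hv0 hmem
    have h3 := (Finset.sum_eq_zero_iff.1 h1) v hv
    simp only [Set.indicator_of_mem hmem, Pi.one_apply, mul_one, ENNReal.ofReal_eq_zero] at h3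
    exact (h2 0 v hv hv0).not_ge h3
  have hinv : ∀ i, ∀ᵐ ω ∂μ, (shiftE (eZ d i) ω ∈ Nᶜ) = (ω ∈ Nᶜ) := by
    intro i
    have hsub : ∀ᵐ ω ∂μ, ω ∈ Nᶜ → ω ∈ shiftE (eZ d i) ⁻¹' Nᶜ := by
      filter_upwards [hae _ hstep] with ω hω h
      exact hω h _ (eZ_mem_Vfin i) (eZ_ne_zero i)
    have := ae_eq_of_ae_subset_of_measure_ge hsub
      ((measurePreserving_shiftE hμ.1 _).measure_preimage hNm.compl.nullMeasurableSet).le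
      hNm.compl.nullMeasurableSet (measure_ne_top _ _)
    exact this.mono fun ω h => h.symm
  have hpos : ∀ᵐ ω ∂μ, ω ∈ Nᶜ := by
    rcases measure_eq_zero_or_ae_mem hμ hNm.compl hinv with h | h
    · exfalso
      have h1 : Q (Nᶜ) = 0 := hQμ h
      have h2 : Q Set.univ = 0 := by
        rw [← Set.union_compl_self N]
        exact measure_union_null hQN h1
      simp at h2
    · exact h
  rw [← hQd]
  exact withDensity_absolutelyContinuous' hrm.aemeasurable hpos

/-- Bounded harmonic functions of the environment are constant. -/
lemma exists_ae_eq_const_of_harmonic {d : ℕ} {μ Q : Measure (Env d)} [IsProbabilityMeasure μ]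
    [IsProbabilityMeasure Q] (hμ : StationaryErgodic μ) {E : Sd d → Sd d} (hE : Measurable E)
    (hell : ∀ᵐ ω ∂μ, ∀ x : Zd d, ∀ v ∈ Vfin d, v ≠ 0 → 0 < (E (ω x)).1 v)
    (hQμ : Q ≪ μ) (hQ : envStep E Q = Q) {h : Env d → ℝ} (hm : Measurable h)
    (h0 : ∀ ω, 0 ≤ h ω) (h1 : ∀ ω, h ω ≤ 1)
    (hharm : ∀ ω, h ω = ∑ v ∈ Vfin d, envKer E ω 0 v * h (shiftE v ω)) :
    ∃ a, ∀ᵐ ω ∂Q, h ω = a := by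
  have hsq : Measurable fun ω => ENNReal.ofReal (h ω ^ 2) := (hm.pow_const 2).ennreal_ofReal
  have hvar : ∀ ω, ∑ v ∈ Vfin d, envKer E ω 0 v * (h (shiftE v ω) - h ω) ^ 2 =
      ∑ v ∈ Vfin d, envKer E ω 0 v * h (shiftE v ω) ^ 2 - h ω ^ 2 := by
    intro ω
    have hs : ∑ v ∈ Vfin d, envKer E ω 0 v = 1 := (E (ω 0)).2.2.2
    have : ∀ v, envKer E ω 0 v * (h (shiftE v ω) - h ω) ^ 2 =
        envKer E ω 0 v * h (shiftE v ω) ^ 2 - 2 * h ω * (envKer E ω 0 v * h (shiftE v ω)) +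
          h ω ^ 2 * envKer E ω 0 v := fun v => by ring
    simp only [this, Finset.sum_add_distrib, Finset.sum_sub_distrib, ← Finset.mul_sum, ← hharm, hs]
    ring
  have hof : ∀ ω, ∑ v ∈ Vfin d, ENNReal.ofReal (envKer E ω 0 v) *
      ENNReal.ofReal (h (shiftE v ω) ^ 2) =
      ENNReal.ofReal (∑ v ∈ Vfin d, envKer E ω 0 v * h (shiftE v ω) ^ 2) := by
    intro ω
    rw [ENNReal.ofReal_sum_of_nonneg fun v _ => mul_nonneg (envKer_nonneg E ω 0 v) (sq_nonneg _)]
    exact Finset.sum_congr rfl fun v _ => (ENNReal.ofReal_mul (envKer_nonneg E ω 0 v)).symm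
  have h_integral := lintegral_envStep hE Q hsq
  rw [hQ] at h_integral
  have hae := ae_eq_of_ae_le_of_lintegral_le (μ := Q) (f := fun ω => ENNReal.ofReal (h ω ^ 2))
    (g := fun ω => ∑ v ∈ Vfin d, ENNReal.ofReal (envKer E ω 0 v) *
      ENNReal.ofReal (h (shiftE v ω) ^ 2))
    (ae_of_all _ fun ω => by
      simp only [hof]
      refine ENNReal.ofReal_le_ofReal ?_
      have := hvar ω ▸ Finset.sum_nonneg fun v (_ : v ∈ Vfin d) =>
        mul_nonneg (envKer_nonneg E ω 0 v) (sq_nonneg (h (shiftE v ω) - h ω))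
      linarith)
    (ne_top_of_le_ne_top ENNReal.one_ne_top (by
      refine (lintegral_mono (g := fun _ => 1) fun ω => ?_).trans (by simp)
      exact ENNReal.ofReal_le_one.2 (pow_le_one₀ (h0 ω) (h1 ω))))
    (Finset.measurable_sum _ fun v _ => (measurable_envKer hE 0 v).ennreal_ofReal.mul
      (hsq.comp (measurable_shiftE v))).aemeasurable h_integral.ge
  have hμQ := absolutelyContinuous_of_envStep_eq hμ hE hell hQμ hQ
  have hconst : ∀ᵐ ω ∂μ, ∀ i, h (shiftE (eZ d i) ω) = h ω := by
    filter_upwards [hμQ.ae_le hae, hell] with ω hω hpos i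
    simp only [hof] at hω
    rw [ENNReal.ofReal_eq_ofReal_iff (sq_nonneg _) (Finset.sum_nonneg fun v _ =>
      mul_nonneg (envKer_nonneg E ω 0 v) (sq_nonneg _))] at hω
    have hz := hvar ω
    rw [← hω, sub_self] at hz
    have h2 := (Finset.sum_eq_zero_iff_of_nonneg fun v _ =>
      mul_nonneg (envKer_nonneg E ω 0 v) (sq_nonneg _)).1 hz _ (eZ_mem_Vfin i)
    have h3 : envKer E ω 0 (eZ d i) ≠ 0 := (hpos 0 _ (eZ_mem_Vfin i) (eZ_ne_zero i)).ne'
    have h4 := (mul_eq_zero.1 h2).resolve_left h3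
    exact sub_eq_zero.1 (pow_eq_zero_iff two_ne_zero |>.1 h4)
  obtain ⟨a, ha⟩ := exists_ae_eq_const hμ hm fun i => hconst.mono fun ω hω => hω i
  exact ⟨a, hQμ.ae_le ha⟩

/-- The maximum of the first Birkhoff sums, including the empty one. -/
def birkhoffMax {X : Type*} (T : X → X) (f : X → ℝ) : ℕ → X → ℝ
  | 0 => fun _ => 0
  | N + 1 => fun x => max 0 (f x + birkhoffMax T f N (T x))

lemma birkhoffMax_nonneg {X : Type*} (T : X → X) (f : X → ℝ) (N : ℕ) (x : X) :
    0 ≤ birkhoffMax T f N x := by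
  cases N
  exacts [le_rfl, le_max_left _ _]

lemma birkhoffMax_le_succ {X : Type*} (T : X → X) (f : X → ℝ) (N : ℕ) (x : X) :
    birkhoffMax T f N x ≤ birkhoffMax T f (N + 1) x := by
  induction N generalizing x with
  | zero => exact birkhoffMax_nonneg T f 1 x
  | succ N ih => exact max_le_max le_rfl (add_le_add le_rfl (ih (T x)))

lemma birkhoffSum_le_birkhoffMax {X : Type*} (T : X → X) (f : X → ℝ) (N : ℕ) (x : X) :
    birkhoffSum T f N x ≤ birkhoffMax T f N x := by
  induction N generalizing x with
  | zero => simp [birkhoffMax]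
  | succ N ih =>
    rw [birkhoffSum_succ']
    exact (add_le_add le_rfl (ih (T x))).trans (le_max_right _ _)

lemma birkhoffMax_le {X : Type*} (T : X → X) {f : X → ℝ} {C : ℝ} (hC : ∀ x, |f x| ≤ C) (N : ℕ)
    (x : X) : birkhoffMax T f N x ≤ N * C := by
  induction N generalizing x with
  | zero => simp [birkhoffMax]
  | succ N ih =>
    have h0 : 0 ≤ C := (abs_nonneg _).trans (hC x)
    refine max_le (by positivity) ?_
    have := (le_abs_self _).trans (hC x)
    have := ih (T x)
    push_cast
    linarith

lemma measurable_birkhoffMax {X : Type*} [MeasurableSpace X] {T : X → X} (hT : Measurable T)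
    {f : X → ℝ} (hf : Measurable f) (N : ℕ) : Measurable (birkhoffMax T f N) := by
  induction N with
  | zero => exact measurable_const
  | succ N ih => exact measurable_const.max (hf.add (ih.comp hT))

/-- The set where the Birkhoff sums are not bounded above. -/
def birkhoffUnbounded {X : Type*} (T : X → X) (f : X → ℝ) : Set X :=
  {x | ¬ BddAbove (Set.range fun n => birkhoffSum T f n x)}

lemma preimage_birkhoffUnbounded {X : Type*} (T : X → X) (f : X → ℝ) :
    T ⁻¹' birkhoffUnbounded T f = birkhoffUnbounded T f := by
  ext x
  simp only [birkhoffUnbounded, Set.mem_preimage, Set.mem_ofPred_eq, not_iff_not]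
  constructor
  · rintro ⟨B, hB⟩
    refine ⟨max 0 (f x + B), ?_⟩
    rintro _ ⟨n, rfl⟩
    cases n with
    | zero => simp
    | succ n =>
      simp only [birkhoffSum_succ']
      exact le_max_of_le_right (add_le_add le_rfl (hB ⟨n, rfl⟩))
  · rintro ⟨B, hB⟩
    refine ⟨B - f x, ?_⟩
    rintro _ ⟨n, rfl⟩
    have := hB ⟨n + 1, rfl⟩
    simp only [birkhoffSum_succ'] at this
    simp only
    linarith

lemma measurableSet_birkhoffUnbounded {X : Type*} [MeasurableSpace X] {T : X → X}
    (hT : Measurable T) {f : X → ℝ} (hf : Measurable f) :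
    MeasurableSet (birkhoffUnbounded T f) :=
  (measurableSet_bddAbove_range fun _ =>
    Finset.measurable_sum _ fun k _ => hf.comp (hT.iterate k)).compl

/-- A form of the maximal ergodic theorem. -/
lemma setIntegral_birkhoffUnbounded_nonneg {X : Type*} [MeasurableSpace X] {m : Measure X}
    [IsFiniteMeasure m] {T : X → X} (hT : MeasurePreserving T m m) {f : X → ℝ}
    (hf : Measurable f) {C : ℝ} (hC : ∀ x, |f x| ≤ C) :
    0 ≤ ∫ x in birkhoffUnbounded T f, f x ∂m := by
  set A := birkhoffUnbounded T f with hA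
  have hAm : MeasurableSet A := measurableSet_birkhoffUnbounded hT.measurable hf
  set r : ℕ → X → ℝ := fun N x => min (f x + birkhoffMax T f N (T x)) 0 with hr
  have hrm : ∀ N, Measurable (r N) := fun N =>
    (hf.add ((measurable_birkhoffMax hT.measurable hf N).comp hT.measurable)).min measurable_const
  have hrb : ∀ N x, |r N x| ≤ C := by
    intro N x
    have h1 := birkhoffMax_nonneg T f N (T x)
    have h2 := abs_le.1 (hC x)
    rw [abs_le]
    exact ⟨le_min (by linarith) (by linarith), (min_le_right _ _).trans (by linarith)⟩
  have h_integral : ∀ (g : X → ℝ) (B : ℝ), Measurable g → (∀ x, |g x| ≤ B) → IntegrableOn g A m :=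
    fun g B hg hB => Integrable.of_bound hg.aestronglyMeasurable B (ae_of_all _ hB)
  have hMb : ∀ N x, |birkhoffMax T f N x| ≤ N * C := fun N x => by
    rw [abs_of_nonneg (birkhoffMax_nonneg T f N x)]
    exact birkhoffMax_le T hC N x
  have hMm := measurable_birkhoffMax hT.measurable hf
  have hTA : MeasurePreserving T (m.restrict A) (m.restrict A) := by
    have := hT.restrict_preimage hAm
    rwa [hA, preimage_birkhoffUnbounded] at this
  have hle : ∀ N, ∫ x in A, r N x ∂m ≤ ∫ x in A, f x ∂m := by
    intro N
    have hdec : ∀ x, f x = birkhoffMax T f (N + 1) x - birkhoffMax T f N (T x) + r N x := by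
      intro x
      have := max_add_min (0 : ℝ) (f x + birkhoffMax T f N (T x))
      simp only [hr, birkhoffMax]
      rw [min_comm]
      linarith
    have hcomp : ∫ x in A, birkhoffMax T f N (T x) ∂m = ∫ x in A, birkhoffMax T f N x ∂m := by
      conv_rhs => rw [← hTA.map_eq]
      rw [integral_map hT.measurable.aemeasurable (hMm N).aestronglyMeasurable]
    have hi1 := h_integral _ _ (hMm (N + 1)) (hMb (N + 1))
    have hi2 := h_integral (fun x => birkhoffMax T f N (T x)) _ ((hMm N).comp hT.measurable)
      fun x => hMb N (T x)
    have hi3 := h_integral _ _ (hrm N) (hrb N)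
    have hmono := integral_mono (h_integral _ _ (hMm N) (hMb N)) hi1 (birkhoffMax_le_succ T f N)
    have hsum : ∫ x in A, f x ∂m = ∫ x in A, birkhoffMax T f (N + 1) x ∂m -
        ∫ x in A, birkhoffMax T f N (T x) ∂m + ∫ x in A, r N x ∂m := by
      rw [integral_congr_ae (ae_of_all _ hdec), ← integral_sub hi1 hi2]
      exact integral_add (hi1.sub hi2) hi3
    linarith
  have hlim : Tendsto (fun N => ∫ x in A, r N x ∂m) atTop (𝓝 (∫ _ in A, (0 : ℝ) ∂m)) := by
    refine tendsto_integral_of_dominated_convergence (fun _ => C)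
      (fun N => (hrm N).aestronglyMeasurable) (integrable_const C)
      (fun N => ae_of_all _ (hrb N)) ?_
    filter_upwards [ae_restrict_mem hAm] with x hx
    have hex : ∃ n, 0 < birkhoffSum T f n x := by
      by_contra! h
      exact hx ⟨0, by rintro _ ⟨n, rfl⟩; exact h n⟩
    obtain ⟨n, hn⟩ := hex
    refine tendsto_const_nhds.congr' ?_
    filter_upwards [eventually_ge_atTop n] with N hN
    have hmono : Monotone fun N => birkhoffMax T f N x :=
      monotone_nat_of_le_succ fun N => birkhoffMax_le_succ T f N x
    have h1 : 0 < birkhoffMax T f (N + 1) x :=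
      hn.trans_le ((birkhoffSum_le_birkhoffMax T f n x).trans (hmono (by omega)))
    have h2 : 0 < f x + birkhoffMax T f N (T x) := by
      simpa [birkhoffMax] using h1
    simp [hr, h2.le]
  rw [integral_zero] at hlim
  exact le_of_tendsto' hlim hle

/-- Prepending a coordinate to a sequence. -/
def seqCons {U : Type*} (t : U) (u : ℕ → U) : ℕ → U
  | 0 => t
  | n + 1 => u n

lemma measurable_seqCons {U : Type*} [MeasurableSpace U] :
    Measurable fun z : U × (ℕ → U) => seqCons z.1 z.2 := by
  refine measurable_pi_lambda _ fun n => ?_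
  cases n with
  | zero => exact measurable_fst
  | succ n => exact (measurable_pi_apply n).comp measurable_snd

lemma map_seqCons {U : Type*} [MeasurableSpace U] (l : Measure U) [IsProbabilityMeasure l] :
    (l.prod (Measure.infinitePi fun _ : ℕ => l)).map (fun z => seqCons z.1 z.2) =
      Measure.infinitePi fun _ : ℕ => l := by
  refine Measure.eq_infinitePi _ fun s t ht => ?_
  classical
  obtain ⟨n, hn⟩ : ∃ n, s ⊆ Finset.range (n + 1) :=
    ⟨s.sup id, fun i hi => Finset.mem_range_succ_iff.2 (Finset.le_sup (f := id) hi)⟩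
  set t' : ℕ → Set U := fun i => if i ∈ s then t i else Set.univ with ht'
  have ht'm : ∀ i, MeasurableSet (t' i) := fun i => by
    simp only [ht']
    split_ifs
    exacts [ht i, MeasurableSet.univ]
  have hprod : ∏ i ∈ s, l (t i) = ∏ i ∈ Finset.range (n + 1), l (t' i) := by
    rw [← Finset.prod_subset hn fun i _ hi => by simp [ht', hi]]
    exact Finset.prod_congr rfl fun i hi => by simp [ht', hi]
  rw [Measure.map_apply measurable_seqCons (MeasurableSet.pi s.countable_toSet fun i _ => ht i)]
  have hset : (fun z : U × (ℕ → U) => seqCons z.1 z.2) ⁻¹' (Set.pi s t) =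
      t' 0 ×ˢ Set.pi (Finset.range n : Set ℕ) fun i => t' (i + 1) := by
    ext z
    simp only [Set.mem_preimage, Set.mem_pi, Finset.mem_coe, Set.mem_prod, Finset.mem_range]
    constructor
    · intro h
      refine ⟨?_, fun i _ => ?_⟩
      · by_cases h0 : 0 ∈ s
        · simpa [ht', h0, seqCons] using h 0 h0
        · simp [ht', h0]
      · by_cases hi : i + 1 ∈ s
        · simpa [ht', hi, seqCons] using h (i + 1) hi
        · simp [ht', hi]
    · rintro ⟨h0, h1⟩ i hi
      have hlt := Finset.mem_range.1 (hn hi)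
      cases i with
      | zero => simpa [ht', hi, seqCons] using h0
      | succ i => simpa [ht', hi, seqCons] using h1 i (by omega)
  rw [hset, Measure.prod_prod, Measure.infinitePi_pi _ fun i _ => ht'm (i + 1), hprod,
    Finset.prod_range_succ', mul_comm]

/-- A random mapping representation of the transition probabilities of the walk. -/
structure IsStepMap {d : ℕ} (E : Sd d → Sd d) {U : Type*} [MeasurableSpace U] (l : Measure U)
    (s : Env d → U → Zd d) : Prop where
  measurable : Measurable (Function.uncurry s)
  law : ∀ ω v, l (s ω ⁻¹' {v}) = ENNReal.ofReal (envKer E ω 0 v)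

/-- The skew product driving the environment seen from the walk by independent innovations. -/
def skewStep {d : ℕ} {U : Type*} (s : Env d → U → Zd d) (z : Env d × (ℕ → U)) :
    Env d × (ℕ → U) :=
  (shiftE (s z.1 (z.2 0)) z.1, fun n => z.2 (n + 1))

lemma measurable_shiftE_uncurry {d : ℕ} :
    Measurable fun z : Zd d × Env d => shiftE z.1 z.2 :=
  measurable_from_prod_countable_right fun x => measurable_shiftE x

lemma measurable_skewStep {d : ℕ} {U : Type*} [MeasurableSpace U] {s : Env d → U → Zd d}
    (hs : Measurable (Function.uncurry s)) : Measurable (skewStep s) := by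
  have h1 : Measurable fun z : Env d × (ℕ → U) => s z.1 (z.2 0) :=
    hs.comp (measurable_fst.prodMk ((measurable_pi_apply 0).comp measurable_snd))
  exact (measurable_shiftE_uncurry.comp (h1.prodMk measurable_fst)).prodMk
    (measurable_pi_lambda _ fun n => (measurable_pi_apply (n + 1)).comp measurable_snd)

lemma IsStepMap.measurable_apply {d : ℕ} {E : Sd d → Sd d} {U : Type*} [MeasurableSpace U]
    {l : Measure U} {s : Env d → U → Zd d} (hs : IsStepMap E l s) (ω : Env d) :
    Measurable (s ω) := hs.measurable.comp measurable_prodMk_left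

lemma IsStepMap.lintegral_comp {d : ℕ} {E : Sd d → Sd d} {U : Type*} [MeasurableSpace U]
    {l : Measure U} {s : Env d → U → Zd d} (hs : IsStepMap E l s) (ω : Env d)
    (G : Zd d → ℝ≥0∞) :
    ∫⁻ t, G (s ω t) ∂l = ∑ v ∈ Vfin d, ENNReal.ofReal (envKer E ω 0 v) * G v := by
  rw [← lintegral_map (μ := l) (g := s ω) (f := G) (measurable_of_countable G)
    (hs.measurable_apply ω), lintegral_countable', tsum_eq_sum (s := Vfin d)]
  · refine Finset.sum_congr rfl fun v _ => ?_
    rw [Measure.map_apply (hs.measurable_apply ω) (measurableSet_singleton v), hs.law, mul_comm]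
  · intro v hv
    rw [Measure.map_apply (hs.measurable_apply ω) (measurableSet_singleton v), hs.law,
      show envKer E ω 0 v = 0 from (E (ω 0)).2.2.1 v hv]
    simp

lemma IsStepMap.lintegral_skewStep {d : ℕ} {E : Sd d → Sd d} {U : Type*} [MeasurableSpace U]
    {l : Measure U} [IsProbabilityMeasure l] {s : Env d → U → Zd d} (hs : IsStepMap E l s)
    (ω : Env d) {F : Env d × (ℕ → U) → ℝ≥0∞} (hF : Measurable F) :
    ∫⁻ u, F (skewStep s (ω, u)) ∂(Measure.infinitePi fun _ : ℕ => l) =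
      ∑ v ∈ Vfin d, ENNReal.ofReal (envKer E ω 0 v) *
        ∫⁻ u, F (shiftE v ω, u) ∂(Measure.infinitePi fun _ : ℕ => l) := by
  have hm : Measurable fun u => F (skewStep s (ω, u)) :=
    hF.comp ((measurable_skewStep hs.measurable).comp measurable_prodMk_left)
  have hmc : Measurable fun z : U × (ℕ → U) => F (skewStep s (ω, seqCons z.1 z.2)) :=
    hm.comp measurable_seqCons
  conv_lhs => rw [← map_seqCons l]
  rw [lintegral_map hm measurable_seqCons, lintegral_prod _ hmc.aemeasurable]
  exact hs.lintegral_comp ω fun v =>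
    ∫⁻ u, F (shiftE v ω, u) ∂(Measure.infinitePi fun _ : ℕ => l)

lemma IsStepMap.measurePreserving_skewStep {d : ℕ} {E : Sd d → Sd d} (hE : Measurable E)
    {U : Type*} [MeasurableSpace U] {l : Measure U} [IsProbabilityMeasure l]
    {s : Env d → U → Zd d} (hs : IsStepMap E l s) {Q : Measure (Env d)} [IsProbabilityMeasure Q]
    (hQ : envStep E Q = Q) :
    MeasurePreserving (skewStep s) (Q.prod (Measure.infinitePi fun _ : ℕ => l))
      (Q.prod (Measure.infinitePi fun _ : ℕ => l)) := by
  have hT := measurable_skewStep hs.measurable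
  refine ⟨hT, Measure.ext fun D hD => ?_⟩
  have h1 : Measurable (D.indicator (1 : Env d × (ℕ → U) → ℝ≥0∞)) := measurable_one.indicator hD
  have h1T : Measurable fun z => D.indicator (1 : Env d × (ℕ → U) → ℝ≥0∞) (skewStep s z) :=
    h1.comp hT
  rw [← lintegral_indicator_one hD, lintegral_map h1 hT,
    lintegral_prod _ h1T.aemeasurable, ← lintegral_indicator_one hD,
    lintegral_prod _ h1.aemeasurable]
  simp_rw [hs.lintegral_skewStep _ h1]
  rw [← lintegral_envStep hE Q (f := fun ω =>
    ∫⁻ u, D.indicator 1 (ω, u) ∂(Measure.infinitePi fun _ : ℕ => l)) h1.lintegral_prod_right', hQ]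

/-- Additive functionals with negative drift are bounded above. -/
lemma IsStepMap.ae_bddAbove_birkhoffSum {d : ℕ} {μ Q : Measure (Env d)} [IsProbabilityMeasure μ]
    [IsProbabilityMeasure Q] (hμ : StationaryErgodic μ) {E : Sd d → Sd d} (hE : Measurable E)
    (hell : ∀ᵐ ω ∂μ, ∀ x : Zd d, ∀ v ∈ Vfin d, v ≠ 0 → 0 < (E (ω x)).1 v)
    (hQμ : Q ≪ μ) (hQ : envStep E Q = Q)
    {U : Type*} [MeasurableSpace U] {l : Measure U} [IsProbabilityMeasure l]
    {s : Env d → U → Zd d} (hs : IsStepMap E l s)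
    {g : Env d → ℝ} (hg : Measurable g) {C : ℝ} (hC : ∀ ω, |g ω| ≤ C) (hneg : ∫ ω, g ω ∂Q < 0) :
    ∀ᵐ z ∂(Q.prod (Measure.infinitePi fun _ : ℕ => l)),
      BddAbove (Set.range fun n => birkhoffSum (skewStep s) (fun z => g z.1) n z) := by
  set L := Measure.infinitePi fun _ : ℕ => l with hL
  have hT := hs.measurePreserving_skewStep hE hQ
  have hgf : Measurable fun z : Env d × (ℕ → U) => g z.1 := hg.comp measurable_fst
  set A := birkhoffUnbounded (skewStep s) fun z : Env d × (ℕ → U) => g z.1 with hA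
  have hAm : MeasurableSet A := measurableSet_birkhoffUnbounded hT.measurable hgf
  have hmax := setIntegral_birkhoffUnbounded_nonneg hT hgf (C := C) fun z => hC z.1
  rw [← hA] at hmax
  set h : Env d → ℝ := fun ω => L.real (Prod.mk ω ⁻¹' A) with hh
  have hm : Measurable h := (measurable_measure_prodMk_left hAm).ennreal_toReal
  have h1A : Measurable (A.indicator (1 : Env d × (ℕ → U) → ℝ≥0∞)) := measurable_one.indicator hAm
  have hsec : ∀ ω, ∫⁻ u, A.indicator 1 (ω, u) ∂L = L (Prod.mk ω ⁻¹' A) := by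
    intro ω
    rw [← lintegral_indicator_one (measurable_prodMk_left hAm)]
    rfl
  have hharm : ∀ ω, h ω = ∑ v ∈ Vfin d, envKer E ω 0 v * h (shiftE v ω) := by
    intro ω
    have h2 := hs.lintegral_skewStep ω h1A
    have h3 : ∀ z, A.indicator (1 : Env d × (ℕ → U) → ℝ≥0∞) (skewStep s z) =
        A.indicator 1 z := by
      intro z
      have := preimage_birkhoffUnbounded (skewStep s) fun z : Env d × (ℕ → U) => g z.1
      rw [← hA] at this
      have hz : skewStep s z ∈ A ↔ z ∈ A := by
        conv_rhs => rw [← this]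
        rfl
      by_cases hzA : z ∈ A
      · simp [hzA, hz.2 hzA]
      · simp [hzA, mt hz.1 hzA]
    simp only [h3, ← hL, hsec] at h2
    simp only [hh, Measure.real, h2]
    rw [ENNReal.toReal_sum fun v _ => by finiteness]
    refine Finset.sum_congr rfl fun v _ => ?_
    rw [ENNReal.toReal_mul, ENNReal.toReal_ofReal (envKer_nonneg E ω 0 v)]
  obtain ⟨a, ha⟩ := exists_ae_eq_const_of_harmonic hμ hE hell hQμ hQ hm
    (fun _ => measureReal_nonneg) (fun _ => measureReal_le_one) hharm
  have hgi : Integrable (fun z : Env d × (ℕ → U) => g z.1) (Q.prod L) :=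
    Integrable.of_bound hgf.aestronglyMeasurable C (ae_of_all _ fun z => hC z.1)
  have hval : ∫ z in A, g z.1 ∂(Q.prod L) = a * ∫ ω, g ω ∂Q := by
    rw [← integral_indicator hAm, integral_prod _ (hgi.indicator hAm), ← integral_const_mul]
    refine integral_congr_ae ?_
    filter_upwards [ha] with ω hω
    have : (fun u => A.indicator (fun z : Env d × (ℕ → U) => g z.1) (ω, u)) =
        (Prod.mk ω ⁻¹' A).indicator fun _ => g ω := rfl
    rw [this, integral_indicator_const _ (measurable_prodMk_left hAm), smul_eq_mul, ← hω]
  have ha0 : a ≤ 0 := by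
    by_contra! hpos
    rw [hval] at hmax
    exact absurd hmax (mul_neg_of_pos_of_neg hpos hneg).not_ge
  have hA0 : (Q.prod L) A = 0 := by
    rw [Measure.prod_apply hAm, lintegral_eq_zero_iff (measurable_measure_prodMk_left hAm)]
    filter_upwards [ha] with ω hω
    have h4 : h ω = 0 := le_antisymm (hω.trans_le ha0) measureReal_nonneg
    exact (measureReal_eq_zero_iff (by finiteness)).1 h4
  refine (measure_eq_zero_iff_ae_notMem.1 hA0).mono fun z hz => ?_
  exact not_not.1 hz

/-- The transition kernel of the walk, as a function of the environment. -/
def stepKernel {d : ℕ} {E : Sd d → Sd d} (hE : Measurable E) :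
    ProbabilityTheory.Kernel (Env d) (Zd d) where
  toFun ω := ∑ v ∈ Vfin d, ENNReal.ofReal (envKer E ω 0 v) • Measure.dirac v
  measurable' := Measure.measurable_of_measurable_coe _ fun D _ => by
    simp only [Measure.finsetSum_apply, Measure.smul_apply, smul_eq_mul]
    exact Finset.measurable_sum _ fun v _ =>
      (measurable_envKer hE 0 v).ennreal_ofReal.mul_const _

lemma exists_isStepMap {d : ℕ} {E : Sd d → Sd d} (hE : Measurable E) :
    ∃ s : Env d → unitInterval → Zd d, IsStepMap E volume s := by
  have : ProbabilityTheory.IsMarkovKernel (stepKernel hE) := ⟨fun ω => ⟨by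
    change (∑ v ∈ Vfin d, ENNReal.ofReal (envKer E ω 0 v) • Measure.dirac v : Measure (Zd d))
      Set.univ = 1
    simp [Measure.finsetSum_apply, sum_ofReal_envKer]⟩⟩
  obtain ⟨s, hs, hlaw⟩ :=
    ProbabilityTheory.Kernel.exists_measurable_map_eq_unitInterval (stepKernel hE)
  refine ⟨s, hs, fun ω v => ?_⟩
  have hsm : Measurable (s ω) := hs.comp measurable_prodMk_left
  rw [← Measure.map_apply hsm (measurableSet_singleton v), hlaw]
  change (∑ v ∈ Vfin d, ENNReal.ofReal (envKer E ω 0 v) • Measure.dirac v : Measure (Zd d)) {v} = _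
  simp only [Measure.finsetSum_apply, Measure.smul_apply, smul_eq_mul,
    Measure.dirac_apply' _ (measurableSet_singleton v)]
  by_cases hv : v ∈ Vfin d
  · rw [Finset.sum_eq_single_of_mem v hv fun w _ hw => by simp [hw]]
    simp
  · rw [Finset.sum_eq_zero fun w hw => by
      have : w ≠ v := fun h => hv (h ▸ hw)
      simp [this], show envKer E ω 0 v = 0 from (E (ω 0)).2.2.1 v hv, ENNReal.ofReal_zero]

lemma tendsto_inv_mul_of_bddAbove {A : ℕ → ℝ} {b : ℝ}
    (hup : ∀ j : ℕ, BddAbove (Set.range fun n : ℕ => A n - n * (b + ((j : ℝ) + 1)⁻¹)))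
    (hlo : ∀ j : ℕ, BddAbove (Set.range fun n : ℕ => n * (b - ((j : ℝ) + 1)⁻¹) - A n)) :
    Tendsto (fun n : ℕ => (n : ℝ)⁻¹ * A n) atTop (𝓝 b) := by
  rw [Metric.tendsto_atTop]
  intro ε hε
  obtain ⟨j, hj⟩ := exists_nat_one_div_lt (half_pos hε)
  obtain ⟨B, hB⟩ := hup j
  obtain ⟨B', hB'⟩ := hlo j
  obtain ⟨N, hN⟩ := exists_nat_gt ((|B| + |B'|) / (ε / 2))
  refine ⟨N + 1, fun n hn => ?_⟩
  have hn0 : (0 : ℝ) < n := by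
    have : 0 < n := by omega
    exact_mod_cast this
  have h1 : A n - n * (b + ((j : ℝ) + 1)⁻¹) ≤ B := hB ⟨n, rfl⟩
  have h2 : n * (b - ((j : ℝ) + 1)⁻¹) - A n ≤ B' := hB' ⟨n, rfl⟩
  rw [one_div] at hj
  have h3 : |B| + |B'| < n * (ε / 2) := by
    rw [div_lt_iff₀ (half_pos hε)] at hN
    refine hN.trans_le (mul_le_mul_of_nonneg_right ?_ (half_pos hε).le)
    exact_mod_cast (by omega : N ≤ n)
  have h4 := le_abs_self B
  have h5 := le_abs_self B'
  have h6 := abs_nonneg B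
  have h7 := abs_nonneg B'
  have h8 : (n : ℝ) * ((j : ℝ) + 1)⁻¹ < n * (ε / 2) := mul_lt_mul_of_pos_left hj hn0
  rw [Real.dist_eq, show (n : ℝ)⁻¹ * A n - b = (n : ℝ)⁻¹ * (A n - n * b) by field_simp,
    abs_mul, abs_of_pos (inv_pos.2 hn0), inv_mul_lt_iff₀ hn0, abs_lt]
  constructor <;> nlinarith

/-- The ergodic theorem for the environment seen from the walk. -/
lemma IsStepMap.ae_tendsto {d : ℕ} {μ Q : Measure (Env d)} [IsProbabilityMeasure μ]
    [IsProbabilityMeasure Q] (hμ : StationaryErgodic μ) {E : Sd d → Sd d} (hE : Measurable E)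
    (hell : ∀ᵐ ω ∂μ, ∀ x : Zd d, ∀ v ∈ Vfin d, v ≠ 0 → 0 < (E (ω x)).1 v)
    (hQμ : Q ≪ μ) (hQ : envStep E Q = Q)
    {U : Type*} [MeasurableSpace U] {l : Measure U} [IsProbabilityMeasure l]
    {s : Env d → U → Zd d} (hs : IsStepMap E l s)
    {g : Env d → ℝ} (hg : Measurable g) {C : ℝ} (hC : ∀ ω, |g ω| ≤ C) :
    ∀ᵐ z ∂(Q.prod (Measure.infinitePi fun _ : ℕ => l)),
      Tendsto (fun n : ℕ => (n : ℝ)⁻¹ * ∑ k ∈ Finset.range n, g ((skewStep s)^[k] z).1)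
        atTop (𝓝 (∫ ω, g ω ∂Q)) := by
  set b := ∫ ω, g ω ∂Q with hb
  have hgi : Integrable g Q := Integrable.of_bound hg.aestronglyMeasurable C (ae_of_all _ hC)
  have hup := fun j : ℕ => hs.ae_bddAbove_birkhoffSum hμ hE hell hQμ hQ
    (g := fun ω => g ω - (b + ((j : ℝ) + 1)⁻¹)) (hg.sub_const _)
    (C := C + |b + ((j : ℝ) + 1)⁻¹|) (fun ω => (abs_sub _ _).trans (add_le_add (hC ω) le_rfl)) (by
      rw [integral_sub hgi (integrable_const _), ← hb]
      simp only [integral_const, probReal_univ, one_smul]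
      have : (0 : ℝ) < ((j : ℝ) + 1)⁻¹ := by positivity
      linarith)
  have hlo := fun j : ℕ => hs.ae_bddAbove_birkhoffSum hμ hE hell hQμ hQ
    (g := fun ω => (b - ((j : ℝ) + 1)⁻¹) - g ω) (hg.const_sub _)
    (C := |b - ((j : ℝ) + 1)⁻¹| + C) (fun ω => (abs_sub _ _).trans (add_le_add le_rfl (hC ω))) (by
      rw [integral_sub (integrable_const _) hgi, ← hb]
      simp only [integral_const, probReal_univ, one_smul]
      have : (0 : ℝ) < ((j : ℝ) + 1)⁻¹ := by positivity
      linarith)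
  filter_upwards [ae_all_iff.2 hup, ae_all_iff.2 hlo] with z h1 h2
  refine tendsto_inv_mul_of_bddAbove (fun j => ?_) fun j => ?_
  · simpa [birkhoffSum, Finset.sum_sub_distrib, mul_add] using h1 j
  · simpa [birkhoffSum, Finset.sum_sub_distrib, mul_sub] using h2 j

/-- The walk driven by a sequence of innovations. -/
def walkPos {d : ℕ} {U : Type*} (s : Env d → U → Zd d) (ω : Env d) (u : ℕ → U) : ℕ → Zd d
  | 0 => 0
  | k + 1 => walkPos s ω u k + s (shiftE (walkPos s ω u k) ω) (u k)

lemma skewStep_iterate {d : ℕ} {U : Type*} (s : Env d → U → Zd d) (ω : Env d) (u : ℕ → U)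
    (k : ℕ) : (skewStep s)^[k] (ω, u) = (shiftE (walkPos s ω u k) ω, fun n => u (n + k)) := by
  induction k with
  | zero => simp [walkPos]
  | succ k ih =>
    rw [Function.iterate_succ_apply', ih]
    simp only [skewStep, walkPos, shiftE_shiftE, zero_add, Prod.mk.injEq, true_and]
    funext n
    congr 1
    omega

lemma measurable_walkPos {d : ℕ} {U : Type*} [MeasurableSpace U] {s : Env d → U → Zd d}
    (hs : Measurable (Function.uncurry s)) (ω : Env d) : Measurable (walkPos s ω) := by
  refine measurable_pi_lambda _ fun k => ?_
  induction k with
  | zero => exact measurable_const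
  | succ k ih =>
    have h1 : Measurable fun u : ℕ → U => shiftE (walkPos s ω u k) ω :=
      measurable_shiftE_uncurry.comp (ih.prodMk measurable_const)
    have h2 : Measurable fun u : ℕ → U => s (shiftE (walkPos s ω u k) ω) (u k) :=
      hs.comp (h1.prodMk (measurable_pi_apply k))
    exact ih.add h2

lemma measurableSet_pathCylinder {d : ℕ} (n : ℕ) (y : ℕ → Zd d) :
    MeasurableSet {X : ℕ → Zd d | ∀ k ≤ n, X k = y k} := by
  have : {X : ℕ → Zd d | ∀ k ≤ n, X k = y k} = ⋂ k, ⋂ (_ : k ≤ n), {X | X k = y k} := by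
    ext X
    simp
  rw [this]
  refine MeasurableSet.iInter fun k => MeasurableSet.iInter fun _ => ?_
  have hk : Measurable fun X : ℕ → Zd d => X k := measurable_pi_apply k
  exact hk (measurableSet_singleton (y k))

lemma IsStepMap.isQuenchedLaw {d : ℕ} {E : Sd d → Sd d} {U : Type*} [MeasurableSpace U]
    {l : Measure U} [IsProbabilityMeasure l] {s : Env d → U → Zd d} (hs : IsStepMap E l s)
    (ω : Env d) : IsQuenchedLaw d (fun x => E (ω x)) 0
      ((Measure.infinitePi fun _ : ℕ => l).map (walkPos s ω)) := by
  have hm := measurable_walkPos hs.measurable ω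
  refine ⟨Measure.isProbabilityMeasure_map hm.aemeasurable, fun n y => ?_⟩
  rw [Measure.map_apply hm (measurableSet_pathCylinder n y)]
  split_ifs with h0
  · have hset : walkPos s ω ⁻¹' {X | ∀ k ≤ n, X k = y k} =
        Set.pi (Finset.range n : Set ℕ)
          fun k => s (shiftE (y k) ω) ⁻¹' {y (k + 1) - y k} := by
      ext u
      simp only [Set.mem_preimage, Set.mem_ofPred_eq, Set.mem_pi, Finset.mem_coe,
        Finset.mem_range, Set.mem_singleton_iff]
      constructor
      · intro h k hk
        have h1 := h (k + 1) hk
        rw [walkPos, h k hk.le] at h1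
        rw [← h1, add_sub_cancel_left]
      · intro h k hk
        induction k with
        | zero => rw [h0, walkPos]
        | succ k ih =>
          rw [walkPos, ih (by omega), h k hk, add_sub_cancel]
    rw [hset, Measure.infinitePi_pi _ fun k _ =>
      (hs.measurable_apply _) (measurableSet_singleton _)]
    refine Finset.prod_congr rfl fun k _ => ?_
    rw [hs.law, envKer_shiftE, add_zero]
    rfl
  · convert measure_empty (μ := Measure.infinitePi fun _ : ℕ => l)
    rw [Set.eq_empty_iff_forall_notMem]
    exact fun u hu => h0 (hu 0 n.zero_le).symm

/-- The quenched law is unique. -/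
lemma IsQuenchedLaw.unique {d : ℕ} {ω : Env d} {x₀ : Zd d} {P P' : Measure (ℕ → Zd d)}
    (hP : IsQuenchedLaw d ω x₀ P) (hP' : IsQuenchedLaw d ω x₀ P') : P = P' := by
  have := hP.1
  have := hP'.1
  refine ext_of_generate_finite
    {S | ∃ (n : ℕ) (y : ℕ → Zd d), S = {X : ℕ → Zd d | ∀ k ≤ n, X k = y k}} ?_ ?_ ?_ (by simp)
  · refine le_antisymm ?_ (MeasurableSpace.generateFrom_le ?_)
    · refine iSup_le fun a => measurable_iff_comap_le.1 ?_
      refine @measurable_to_countable' _ _ _ _ (MeasurableSpace.generateFrom _) _ fun v => ?_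
      have : (fun X : ℕ → Zd d => X a) ⁻¹' {v} =
          ⋃ (w : Fin (a + 1) → Zd d) (_ : w (Fin.last a) = v),
            {X : ℕ → Zd d | ∀ k ≤ a, X k = if h : k < a + 1 then w ⟨k, h⟩ else 0} := by
        ext X
        simp only [Set.mem_preimage, Set.mem_singleton_iff, Set.mem_iUnion, Set.mem_ofPred_eq,
          exists_prop]
        constructor
        · intro h
          refine ⟨fun k => X k, by simpa using h, fun k hk => ?_⟩
          rw [dif_pos (by omega)]
        · rintro ⟨w, rfl, h⟩
          rw [h a le_rfl, dif_pos (by omega)]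
          rfl
      rw [this]
      exact .iUnion fun w => .iUnion fun _ => MeasurableSpace.measurableSet_generateFrom
        ⟨a, _, rfl⟩
    · rintro _ ⟨n, y, rfl⟩
      exact measurableSet_pathCylinder n y
  · rintro _ ⟨n, y, rfl⟩ _ ⟨n', y', rfl⟩ ⟨X, hX, hX'⟩
    refine ⟨max n n', X, ?_⟩
    ext Y
    simp only [Set.mem_inter_iff, Set.mem_ofPred_eq] at hX hX' ⊢
    constructor
    · rintro ⟨h, h'⟩ k hk
      rcases le_max_iff.1 hk with hk | hk
      · rw [h k hk, hX k hk]
      · rw [h' k hk, hX' k hk]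
    · intro h
      exact ⟨fun k hk => by rw [h k (le_max_of_le_left hk), hX k hk],
        fun k hk => by rw [h k (le_max_of_le_right hk), hX' k hk]⟩
  · rintro _ ⟨n, y, rfl⟩
    rw [hP.2, hP'.2]

lemma envKer_le_one {d : ℕ} (E : Sd d → Sd d) (ω : Env d) (x v : Zd d) : envKer E ω x v ≤ 1 := by
  by_cases hv : v ∈ Vfin d
  · exact (Finset.single_le_sum (f := fun v => envKer E ω x v)
      (fun v _ => envKer_nonneg E ω x v) hv).trans (E (ω x)).2.2.2.le
  · exact ((E (ω x)).2.2.1 v hv).trans_le zero_le_one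

theorem stmt1 (d : ℕ) (hd : 1 ≤ d) (μ : Measure (Env d)) [IsProbabilityMeasure μ]
    (hμ : StationaryErgodic μ)
    (E : Sd d → Sd d) (hE : Measurable E)
    (hbal : ∀ (ω : Env d) (x : Zd d) (i : Fin d),
      (E (ω x)).1 (eZ d i) = (E (ω x)).1 (-eZ d i))
    (hell : ∀ᵐ ω ∂μ, ∀ x : Zd d, ∀ v ∈ Vfin d, v ≠ 0 → 0 < (E (ω x)).1 v)
    (hmom : ∃ p : ℝ, (d : ℝ) < p ∧ ∫⁻ ω, ENNReal.ofReal (cE d E ω 0 ^ (-p)) ∂μ < ⊤) :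
    ∃ b : Zd d → ℝ, b ∈ Sd d ∧
      ∀ᵐ ω ∂μ, ∀ P : Measure (ℕ → Zd d),
        IsQuenchedLaw d (fun x => E (ω x)) 0 P →
        ∀ᵐ X ∂P,
          Tendsto (fun n : ℕ =>
              (n : ℝ)⁻¹ • ∑ k ∈ Finset.range n, ((E (ω (X k))).1 : Zd d → ℝ))
            atTop (𝓝 b) := by
  obtain ⟨Q, hQp, hQμ, hQ⟩ := exists_envStep_eq hd μ hμ.1 hE hbal hell hmom
  have hμQ := absolutelyContinuous_of_envStep_eq hμ hE hell hQμ hQ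
  have hK1 : ∀ v, ∀ ω : Env d, |envKer E ω 0 v| ≤ 1 := fun v ω => by
    rw [abs_of_nonneg (envKer_nonneg E ω 0 v)]
    exact envKer_le_one E ω 0 v
  refine ⟨fun v => ∫ ω, envKer E ω 0 v ∂Q,
    ⟨fun v => integral_nonneg fun ω => envKer_nonneg E ω 0 v, fun v hv => ?_, ?_⟩, ?_⟩
  · have : ∀ ω : Env d, envKer E ω 0 v = 0 := fun ω => (E (ω 0)).2.2.1 v hv
    simp [this]
  · rw [← integral_finsetSum _ fun v _ => Integrable.of_bound
      (measurable_envKer hE 0 v).aestronglyMeasurable 1 (ae_of_all _ (hK1 v))]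
    have : ∀ ω : Env d, ∑ v ∈ Vfin d, envKer E ω 0 v = 1 := fun ω => (E (ω 0)).2.2.2
    simp [this]
  obtain ⟨s, hs⟩ := exists_isStepMap hE
  have hae := ae_all_iff.2 fun v => hs.ae_tendsto hμ hE hell hQμ hQ (measurable_envKer hE 0 v)
    (hK1 v)
  filter_upwards [hμQ.ae_le (Measure.ae_ae_of_ae_prod hae)] with ω hω P hP
  rw [hP.unique (hs.isQuenchedLaw ω)]
  have hm : ∀ (n : ℕ) (v : Zd d), Measurable fun X : ℕ → Zd d =>
      (n : ℝ)⁻¹ * ∑ k ∈ Finset.range n, envKer E ω (X k) v := fun n v =>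
    (Finset.measurable_sum _ fun k _ => (measurable_of_countable fun x => envKer E ω x v).comp
      (measurable_pi_apply k)).const_mul _
  have hcoord : ∀ᵐ X ∂((Measure.infinitePi fun _ : ℕ => (volume : Measure unitInterval)).map
      (walkPos s ω)), ∀ v, Tendsto (fun n : ℕ =>
        (n : ℝ)⁻¹ * ∑ k ∈ Finset.range n, envKer E ω (X k) v) atTop
        (𝓝 (∫ ω, envKer E ω 0 v ∂Q)) := by
    rw [ae_all_iff]
    intro v
    rw [ae_map_iff (measurable_walkPos hs.measurable ω).aemeasurable
      (measurableSet_tendsto _ fun n => hm n v)]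
    filter_upwards [hω] with u hu
    simpa only [skewStep_iterate, envKer_shiftE, add_zero] using hu v
  filter_upwards [hcoord] with X hX
  rw [tendsto_pi_nhds]
  intro v
  simp only [Pi.smul_apply, Finset.sum_apply, smul_eq_mul]
  exact hX v
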